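/- For every strictly increasing sequence of integers d = (d_0 < d_1 < ... < d_c) with c ≤ n, there exists a finitely generated graded Cohen-Macaulay module M of codimension c over the polynomial ring S = K[x_1,...,x_n] whose minimal graded free resolution is pure with degree sequence d; equivalently, every pure Betti table with degree sequence of length c ≤ n is a positive rational multiple of the Betti table of a Cohen-Macaulay S-module. -/

import Mathlib

open MvPolynomial Finset Module

noncomputable section

/-- The standard graded polynomial ring `S = K[x_1, …, x_n]`. -/
abbrev PolyS (K : Type) [Field K] (n : ℕ) : Type := MvPolynomial (Fin n) K

/-- The `K`-subspace of homogeneous polynomials of integer degree `z`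
(it is `0` if `z < 0`). -/
def homogZ (K : Type) [Field K] (n : ℕ) (z : ℤ) : Submodule K (PolyS K n) :=
  ⨆ (_ : 0 ≤ z), MvPolynomial.homogeneousSubmodule (Fin n) K z.toNat

/-- The degree-`ℓ` piece of the graded free module `⊕ₚ S(-dg p)`. -/
def freePiece {K : Type} [Field K] {n r : ℕ} (dg : Fin r → ℤ) (ℓ : ℤ) :
    Submodule K (Fin r → PolyS K n) :=
  Submodule.pi Set.univ fun p => homogZ K n (ℓ - dg p)

/-- A (homologically indexed) finite complex of graded free `S`-modules
`F₀ ← F₁ ← ⋯ ← F_len ← 0`, where `Fᵢ = ⊕ₚ S(-deg i p)` and the (degree `0`)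
map `Fᵢ₊₁ → Fᵢ` is given by the matrix `dd i`, whose entries are homogeneous
of the appropriate degrees. -/
structure FreeComplex (K : Type) [Field K] (n : ℕ) where
  len : ℕ
  rk : ℕ → ℕ
  deg : (i : ℕ) → Fin (rk i) → ℤ
  dd : (i : ℕ) → Matrix (Fin (rk i)) (Fin (rk (i+1))) (PolyS K n)
  rk_eq_zero : ∀ i, len < i → rk i = 0
  isHomog : ∀ i p q, dd i p q ∈ homogZ K n (deg (i+1) q - deg i p)
  isComplex : ∀ i, dd i * dd (i+1) = 0

variable {K : Type} [Field K] {n : ℕ}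

/-- `F` is exact in positive homological degrees; that is, it is a graded free
resolution of the finitely generated graded module `M = coker (F₁ → F₀)`. -/
def IsResolution (F : FreeComplex K n) : Prop :=
  ∀ i, LinearMap.ker ((F.dd i).mulVecLin) = LinearMap.range ((F.dd (i+1)).mulVecLin)

/-- The complex is minimal: entries of the differentials lie in the maximal ideal,
i.e. all (constant) entries between generators of equal degrees vanish. -/
def IsMinimal (F : FreeComplex K n) : Prop :=
  ∀ i p q, F.deg (i+1) q = F.deg i p → F.dd i p q = 0

/-- Betti number `β_{i,j}`: the number of generators of `Fᵢ` of degree `j`. -/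
def bettiNum (F : FreeComplex K n) (i : ℕ) (j : ℤ) : ℕ :=
  (Finset.univ.filter fun p => F.deg i p = j).card

/-- The dimension of the degree-`ℓ` piece of the module `M = coker (F₁ → F₀)`
resolved by `F`. -/
def MPieceDim (F : FreeComplex K n) (ℓ : ℤ) : ℕ :=
  finrank K ((freePiece (F.deg 0) ℓ) ⧸
    (Submodule.comap (freePiece (F.deg 0) ℓ).subtype
      ((LinearMap.range ((F.dd 0).mulVecLin)).restrictScalars K)))

/-- The Hilbert polynomial of the twisted free module `S(-a)` in `n` variables:
`binom (t - a + n - 1, n - 1)`. -/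
def genHilb (n : ℕ) (a : ℤ) : Polynomial ℚ :=
  if n = 0 then 0 else
    Polynomial.C (((n - 1).factorial : ℚ))⁻¹ *
      ∏ k ∈ Finset.range (n - 1),
        (Polynomial.X - Polynomial.C (a : ℚ) + Polynomial.C ((k : ℚ) + 1))

/-- The Hilbert polynomial of `M = coker (F₁ → F₀)`, computed from the free
resolution `F` by additivity. -/
def hilbPoly (F : FreeComplex K n) : Polynomial ℚ :=
  ∑ i ∈ Finset.range (F.len + 1),
    Polynomial.C ((-1 : ℚ) ^ i) * ∑ p : Fin (F.rk i), genHilb n (F.deg i p)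

/-- The Krull dimension of a module read off from its Hilbert polynomial:
`0` for the zero polynomial (finite length), `deg + 1` otherwise. -/
def polyDim (P : Polynomial ℚ) : ℕ := if P = 0 then 0 else P.natDegree + 1

/-- `M = coker (F₁ → F₀)` is a Cohen-Macaulay module of codimension `c`:
`F` is a minimal free resolution of length exactly `c` (so `pd M = c`, and by
Auslander–Buchsbaum `depth M = n - c`) and `dim M = n - c`. -/
def IsCMcodim (F : FreeComplex K n) (c : ℕ) : Prop :=
  IsResolution F ∧ IsMinimal F ∧ (∀ i, c < i → F.rk i = 0) ∧ F.rk c ≠ 0 ∧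
    polyDim (hilbPoly F) = n - c

/-- The multiplicity `e(M)` of a module of codimension `c`, computed from the
Betti numbers of a free resolution:
`e(M) = ((-1)^c / c!) ⬝ Σ_{i,j} (-1)^i β_{i,j} j^c`. -/
def multQ (F : FreeComplex K n) (c : ℕ) : ℚ :=
  ((-1 : ℚ) ^ c / c.factorial) *
    ∑ i ∈ Finset.range (F.len + 1),
      (-1 : ℚ) ^ i * ∑ p : Fin (F.rk i), ((F.deg i p : ℚ)) ^ c




theorem acyclicity_aux {R : Type} [CommRing R] (rs : List R) :
    ∀ (M : ℕ → Type) [∀ i, AddCommGroup (M i)] [∀ i, Module R (M i)]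
      (d : ∀ i, M (i + 1) →ₗ[R] M i) (_hdd : ∀ i z, d i (d (i + 1) z) = 0)
      (L s : ℕ) (_hreg : ∀ i, RingTheory.Sequence.IsWeaklyRegular (M i) rs)
      (_htop : ∀ i, L < i → Subsingleton (M i))
      (_htors : ∀ r ∈ rs, ∀ i, s ≤ i → ∀ z : M (i + 1), d i z = 0 →
        ∃ (k : ℕ) (w : M (i + 1 + 1)), r ^ k • z = d (i + 1) w)
      (i : ℕ) (_ : s ≤ i) (_ : L < i + 1 + rs.length) (z : M (i + 1)) (_ : d i z = 0),
      ∃ w, d (i + 1) w = z := by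
  induction rs with
  | nil =>
    intro M _ _ d hdd L s hreg htop htors i hs hL z hz
    have := htop (i + 1) (by simpa using hL)
    exact ⟨0, Subsingleton.elim _ _⟩
  | cons r rs ih =>
    intro M _ _ d hdd L s hreg htop htors i hs hL z hz
    have hr : ∀ i, IsSMulRegular (M i) r := fun i =>
      ((RingTheory.Sequence.isWeaklyRegular_cons_iff (M i) r rs).1 (hreg i)).1
    have hq : ∀ i, RingTheory.Sequence.IsWeaklyRegular (QuotSMulTop r (M i)) rs := fun i =>
      ((RingTheory.Sequence.isWeaklyRegular_cons_iff (M i) r rs).1 (hreg i)).2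
    -- membership in `r • ⊤`
    have hmem : ∀ i (y : M i), (Submodule.Quotient.mk y : QuotSMulTop r (M i)) = 0 →
        ∃ y', y = r • y' := by
      intro i y hy
      rw [Submodule.Quotient.mk_eq_zero] at hy
      obtain ⟨y', -, h⟩ := (Submodule.mem_smul_pointwise_iff_exists _ _ _).1 hy
      exact ⟨y', h.symm⟩
    have hmem' : ∀ i (y : M i), (Submodule.Quotient.mk (r • y) : QuotSMulTop r (M i)) = 0 := by
      intro i y
      rw [Submodule.Quotient.mk_eq_zero]
      exact (Submodule.mem_smul_pointwise_iff_exists _ _ _).2 ⟨y, trivial, rfl⟩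
    have hsurj : ∀ i (z : QuotSMulTop r (M i)), ∃ y : M i, Submodule.Quotient.mk y = z :=
      fun i z => Submodule.Quotient.mk_surjective _ z
    have h1 : ∀ i (z : QuotSMulTop r (M (i + 1 + 1))),
        QuotSMulTop.map r (d i) (QuotSMulTop.map r (d (i + 1)) z) = 0 := by
      intro i z
      obtain ⟨z, rfl⟩ := hsurj _ z
      rw [QuotSMulTop.map_apply_mk, QuotSMulTop.map_apply_mk, hdd, Submodule.Quotient.mk_zero]
    have h2 : ∀ i, L < i → Subsingleton (QuotSMulTop r (M i)) := by
      intro i hi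
      have := htop i hi
      constructor
      intro a b
      obtain ⟨a, rfl⟩ := hsurj _ a
      obtain ⟨b, rfl⟩ := hsurj _ b
      rw [Subsingleton.elim a b]
    have h3 : ∀ r2 ∈ rs, ∀ i, s + 1 ≤ i → ∀ z : QuotSMulTop r (M (i + 1)),
        QuotSMulTop.map r (d i) z = 0 →
        ∃ (k : ℕ) (w : QuotSMulTop r (M (i + 1 + 1))),
          r2 ^ k • z = QuotSMulTop.map r (d (i + 1)) w := by
      intro r2 hr2 i hi z hz
      obtain ⟨z, rfl⟩ := hsurj _ z
      obtain ⟨j, rfl⟩ : ∃ j, i = j + 1 := ⟨i - 1, by omega⟩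
      rw [QuotSMulTop.map_apply_mk] at hz
      obtain ⟨y, hy⟩ := hmem _ _ hz
      have hdy : d j y = 0 := by
        apply hr j
        simp only [smul_zero]
        rw [← map_smul, ← hy, hdd]
      obtain ⟨k, w, hw⟩ := htors r2 (by simp [hr2]) j (by omega) y hdy
      have h2 : d (j + 1) (r2 ^ k • z - r • w) = 0 := by
        rw [map_sub, map_smul, map_smul, hy, ← hw, smul_comm, sub_self]
      obtain ⟨m, v, hv⟩ := htors r2 (by simp [hr2]) (j + 1) (by omega) _ h2
      refine ⟨m + k, Submodule.Quotient.mk v, ?_⟩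
      rw [QuotSMulTop.map_apply_mk, ← hv, smul_sub, Submodule.Quotient.mk_sub,
        smul_comm (r2 ^ m) r w, hmem', sub_zero, smul_smul, pow_add]
      rfl
    have key := ih (fun i => QuotSMulTop r (M i)) (fun i => QuotSMulTop.map r (d i)) h1
      L (s + 1) hq h2 h3
    obtain ⟨k, w, hw⟩ := htors r (by simp) i hs z hz
    induction k generalizing w with
    | zero => exact ⟨w, by simpa using hw.symm⟩
    | succ k ihk =>
      obtain ⟨v, hv⟩ := key (i + 1) (by omega) (by simp at hL; omega)
        (Submodule.Quotient.mk w) (by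
          rw [QuotSMulTop.map_apply_mk, ← hw, pow_succ', mul_smul, hmem'])
      obtain ⟨v, rfl⟩ := Submodule.Quotient.mk_surjective _ v
      rw [QuotSMulTop.map_apply_mk] at hv
      obtain ⟨u, hu⟩ := hmem _ (w - d (i + 1 + 1) v) (by
        rw [Submodule.Quotient.mk_sub, hv, sub_self])
      apply ihk u
      apply hr
      simp only
      rw [smul_smul, ← pow_succ', hw, ← map_smul, ← hu, map_sub, hdd, sub_zero]

theorem isWeaklyRegular_X {K : Type} [Field K] {n : ℕ} (c : ℕ) (hc : c ≤ n) (r : ℕ) :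
    RingTheory.Sequence.IsWeaklyRegular (Fin r → MvPolynomial (Fin n) K)
      (List.ofFn fun l : Fin c => (X (Fin.castLE hc l) : MvPolynomial (Fin n) K)) := by
  have hmem : ∀ (I : Ideal (MvPolynomial (Fin n) K)) (v : Fin r → MvPolynomial (Fin n) K),
      v ∈ I • (⊤ : Submodule (MvPolynomial (Fin n) K) (Fin r → MvPolynomial (Fin n) K)) ↔
        ∀ p, v p ∈ I := by
    intro I v
    constructor
    · intro h p
      have h2 := Submodule.mem_map_of_mem (f := (LinearMap.proj (R := MvPolynomial (Fin n) K)
        (φ := fun _ : Fin r => MvPolynomial (Fin n) K) p)) h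
      rw [Submodule.map_smul''] at h2
      have h3 := Submodule.smul_mono (le_refl I) (le_top (a := (⊤ : Submodule _ _).map
        (LinearMap.proj (R := MvPolynomial (Fin n) K)
          (φ := fun _ : Fin r => MvPolynomial (Fin n) K) p))) h2
      simpa using h3
    · intro h
      rw [← Finset.univ_sum_single v]
      refine Submodule.sum_mem _ fun p _ => ?_
      have : Pi.single p (v p) = v p • (Pi.single p 1 : Fin r → MvPolynomial (Fin n) K) := by
        rw [← Pi.single_smul]; simp
      rw [this]
      exact Submodule.smul_mem_smul (h p) trivial
  constructor
  intro i hi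
  rw [isSMulRegular_iff_right_eq_zero_of_smul]
  intro z hz
  obtain ⟨z, rfl⟩ := Submodule.Quotient.mk_surjective _ z
  rw [← Submodule.Quotient.mk_smul, Submodule.Quotient.mk_eq_zero, hmem] at hz
  rw [Submodule.Quotient.mk_eq_zero, hmem]
  intro p
  have hzp := hz p
  have hi' : i < c := by simpa using hi
  have hI : Ideal.ofList (List.take i (List.ofFn fun l : Fin c =>
      (X (Fin.castLE hc l) : MvPolynomial (Fin n) K))) =
      Ideal.span (X '' {l : Fin n | l.1 < i}) := by
    unfold Ideal.ofList
    congr 1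
    ext f
    simp only [Set.mem_ofPred_eq, Set.mem_image, List.mem_take_iff_getElem]
    constructor
    · rintro ⟨j, hj, rfl⟩
      simp at hj
      exact ⟨⟨j, by omega⟩, hj.1, by simp [Fin.castLE]⟩
    · rintro ⟨l, hl, rfl⟩
      exact ⟨l.1, by simp; omega, by simp [Fin.castLE]⟩
  rw [hI] at hzp ⊢
  rw [mem_ideal_span_X_image] at hzp ⊢
  intro m hm
  simp only [List.getElem_ofFn, Pi.smul_apply, smul_eq_mul] at hzp
  obtain ⟨l, hl, hne⟩ := hzp (m + Finsupp.single (Fin.castLE hc ⟨i, hi'⟩) 1) (by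
    rw [MvPolynomial.mem_support_iff] at hm ⊢
    rwa [mul_comm, coeff_mul_X])
  refine ⟨l, hl, ?_⟩
  have : l ≠ Fin.castLE hc ⟨i, hi'⟩ := by
    rintro rfl
    simp at hl
  rw [Finsupp.add_apply, Finsupp.single_eq_of_ne this, add_zero] at hne
  exact hne

section StepSec
variable {S X : Type} [CommRing S]

/-- `v` is supported on the set described by `T`. -/
def SupOn (T : X → Prop) (v : X →₀ S) : Prop := ∀ y, v y ≠ 0 → T y

open Classical in
/-- Projection to the basis elements satisfying `T`. -/
def prj (T : X → Prop) : (X →₀ S) →ₗ[S] (X →₀ S) where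
  toFun v := v.filter T
  map_add' _ _ := Finsupp.filter_add
  map_smul' _ _ := Finsupp.filter_smul

open Classical in
theorem prj_apply (T : X → Prop) (v : X →₀ S) (y : X) :
    prj T v y = if T y then v y else 0 := by
  simp [prj, Finsupp.filter_apply]

theorem SupOn.add {T : X → Prop} {v w : X →₀ S} (hv : SupOn T v) (hw : SupOn T w) :
    SupOn T (v + w) := by
  intro y hy
  by_contra h
  have h1 : v y = 0 := by by_contra h'; exact h (hv y h')
  have h2 : w y = 0 := by by_contra h'; exact h (hw y h')
  simp [h1, h2] at hy

theorem SupOn.smul {T : X → Prop} {v : X →₀ S} (hv : SupOn T v) (r : S) :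
    SupOn T (r • v) := by
  intro y hy
  apply hv
  intro h
  simp [h] at hy

theorem SupOn.neg {T : X → Prop} {v : X →₀ S} (hv : SupOn T v) :
    SupOn T (-v) := by
  intro y hy
  apply hv
  intro h
  simp [h] at hy

theorem SupOn.sub {T : X → Prop} {v w : X →₀ S} (hv : SupOn T v) (hw : SupOn T w) :
    SupOn T (v - w) := by
  rw [sub_eq_add_neg]; exact hv.add hw.neg

theorem SupOn.zero {T : X → Prop} : SupOn T (0 : X →₀ S) := by
  intro y hy; simp at hy

theorem SupOn.mono {T T' : X → Prop} {v : X →₀ S} (hv : SupOn T v) (h : ∀ y, T y → T' y) :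
    SupOn T' v := fun y hy => h y (hv y hy)

theorem SupOn.and {T T' : X → Prop} {v : X →₀ S} (hv : SupOn T v) (h : SupOn T' v) :
    SupOn (fun y => T y ∧ T' y) v := fun y hy => ⟨hv y hy, h y hy⟩

theorem SupOn.prj {T : X → Prop} {v : X →₀ S} (hv : SupOn T v) (T' : X → Prop) :
    SupOn (fun y => T y ∧ T' y) (prj T' v) := by
  intro y hy
  rw [prj_apply] at hy
  by_cases h : T' y
  · exact ⟨hv y (by simpa [h] using hy), h⟩
  · simp [h] at hy

theorem SupOn.prj' {T : X → Prop} {v : X →₀ S} (hv : SupOn T v) (T' : X → Prop) :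
    SupOn T (_root_.prj T' v) := (hv.prj T').mono fun _ h => h.1

theorem supOn_prj (T' : X → Prop) (v : X →₀ S) : SupOn T' (prj T' v) := by
  intro y hy
  rw [prj_apply] at hy
  by_contra h
  simp [h] at hy

theorem prj_eq_self {T : X → Prop} {v : X →₀ S} (h : SupOn T v) : prj T v = v := by
  ext y
  rw [prj_apply]
  by_cases h' : T y
  · simp [h']
  · have : v y = 0 := by by_contra h2; exact h' (h y h2)
    simp [h', this]

theorem prj_eq_zero {T T' : X → Prop} {v : X →₀ S} (h : SupOn T' v)
    (hT : ∀ y, T' y → ¬ T y) : prj T v = 0 := by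
  ext y
  rw [prj_apply]
  by_cases h' : T y
  · have : v y = 0 := by by_contra h2; exact hT y (h y h2) h'
    simp [h', this]
  · simp [h']

theorem eq_zero_of_supOn {T T' : X → Prop} {v : X →₀ S} (h : SupOn T v) (h' : SupOn T' v)
    (hT : ∀ y, T y → ¬ T' y) : v = 0 := by
  ext y
  by_contra h2
  exact hT y (h y h2) (h' y h2)

/-- The differential of the pushed down complex. -/
def stepD (D : (X →₀ S) →ₗ[S] (X →₀ S)) (deg : X → ℕ) (g : ℕ) (U W : X → Prop) :
    (X →₀ S) →ₗ[S] (X →₀ S) :=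
  (prj fun y => U y ∧ W y) ∘ₗ D ∘ₗ (prj fun y => U y ∧ W y)
  + (prj fun y => U y ∧ W y) ∘ₗ D ∘ₗ (prj fun y => deg y = g ∧ U y) ∘ₗ D ∘ₗ
      (prj fun y => ¬ U y ∧ ¬ W y)
  - (prj fun y => ¬ U y ∧ ¬ W y) ∘ₗ D ∘ₗ (prj fun y => ¬ U y ∧ ¬ W y)

structure StepHyp (D : (X →₀ S) →ₗ[S] (X →₀ S)) (deg : X → ℕ) (g : ℕ) (A U W : X → Prop) :
    Prop where
  presA : ∀ v, SupOn A v → SupOn A (D v)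
  presU : ∀ v, SupOn (fun y => A y ∧ U y) v → SupOn (fun y => A y ∧ U y) (D v)
  presW : ∀ v, SupOn (fun y => A y ∧ W y) v → SupOn (fun y => A y ∧ W y) (D v)
  lt : ∀ v, SupOn (fun y => deg y ≤ g) v → SupOn (fun y => deg y < g) (D v)
  gt : ∀ v, SupOn (fun y => g < deg y) v → SupOn (fun y => g ≤ deg y) (D v)
  sq : ∀ v, SupOn A v → D (D v) = 0
  both : ∀ y, U y → W y → deg y < g
  none : ∀ y, ¬ U y → ¬ W y → g < deg y

variable {D : (X →₀ S) →ₗ[S] (X →₀ S)} {deg : X → ℕ} {g : ℕ} {A U W : X → Prop}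

theorem StepHyp.mid (H : StepHyp D deg g A U W) (z : X →₀ S)
    (hz : SupOn (fun y => g ≤ deg y) z) (hD : D z = 0) :
    D (prj (fun y => deg y = g) z) = 0 := by
  have e : z = prj (fun y => deg y = g) z + prj (fun y => g < deg y) z := by
    ext y
    rw [Finsupp.add_apply, prj_apply, prj_apply]
    by_cases h0 : z y = 0
    · simp [h0]
    · have := hz y h0
      rcases this.eq_or_lt with h | h
      · simp [← h]
      · simp [h, h.ne']
  have h1 := H.lt _ ((supOn_prj (fun y => deg y = g) z).mono fun y h => h.le)
  have h2 := H.gt _ (supOn_prj (fun y => g < deg y) z)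
  have h3 : D (prj (fun y => deg y = g) z) = - D (prj (fun y => g < deg y) z) := by
    rw [eq_neg_iff_add_eq_zero, ← map_add, ← e, hD]
  refine eq_zero_of_supOn h1 (T' := fun y => g ≤ deg y) ?_ (fun y h => by omega)
  rw [h3]; exact h2.neg

/-- basic analysis of the pushed-down differential -/
theorem StepHyp.analysis (H : StepHyp D deg g A U W) (v0 v1 : X →₀ S)
    (h0 : SupOn (fun y => A y ∧ U y ∧ W y) v0)
    (h1 : SupOn (fun y => A y ∧ ¬ U y ∧ ¬ W y) v1) :
    stepD D deg g U W (v0 + v1) =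
      D v0 + D (prj (fun y => deg y = g ∧ U y) (D v1)) - prj (fun y => ¬ U y ∧ ¬ W y) (D v1) ∧
    SupOn (fun y => A y ∧ U y ∧ W y) (D v0) ∧
    SupOn (fun y => A y ∧ U y ∧ W y) (D (prj (fun y => deg y = g ∧ U y) (D v1))) ∧
    SupOn A (D v1) ∧ SupOn (fun y => g ≤ deg y) (D v1) := by
  have a1 : SupOn (fun y => A y ∧ U y ∧ W y) (D v0) := by
    have := (H.presU v0 (h0.mono fun y h => ⟨h.1, h.2.1⟩)).and
      (H.presW v0 (h0.mono fun y h => ⟨h.1, h.2.2⟩))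
    exact this.mono fun y h => ⟨h.1.1, h.1.2, h.2.2⟩
  have a2 : SupOn A (D v1) := H.presA _ (h1.mono fun y h => h.1)
  have a3 : SupOn (fun y => g ≤ deg y) (D v1) :=
    H.gt _ (h1.mono fun y h => H.none y h.2.1 h.2.2)
  have a4 : D (D v1) = 0 := H.sq _ (h1.mono fun y h => h.1)
  have a5 := H.mid _ a3 a4
  have e : prj (fun y => deg y = g) (D v1) =
      prj (fun y => deg y = g ∧ U y) (D v1) + prj (fun y => deg y = g ∧ W y) (D v1) := by
    ext y
    rw [Finsupp.add_apply, prj_apply, prj_apply, prj_apply]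
    have := H.both y
    have := H.none y
    by_cases hg : deg y = g <;> by_cases hU : U y <;> by_cases hW : W y <;> simp [hg, hU, hW] <;>
      simp_all
  have a6 : SupOn (fun y => A y ∧ U y ∧ W y) (D (prj (fun y => deg y = g ∧ U y) (D v1))) := by
    have b1 := H.presU (prj (fun y => deg y = g ∧ U y) (D v1))
      ((a2.prj _).mono fun y h => ⟨h.1, h.2.2⟩)
    have b2 := H.presW (prj (fun y => deg y = g ∧ W y) (D v1))
      ((a2.prj _).mono fun y h => ⟨h.1, h.2.2⟩)
    rw [e, map_add] at a5
    have b3 := b2.neg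
    rw [← eq_neg_of_add_eq_zero_left a5] at b3
    exact (b1.and b3).mono fun y h => ⟨h.1.1, h.1.2, h.2.2⟩
  refine ⟨?_, a1, a6, a2, a3⟩
  have p0 : prj (fun y => U y ∧ W y) (v0 + v1) = v0 := by
    rw [map_add, prj_eq_self (h0.mono fun y h => h.2),
      prj_eq_zero h1 (fun y h h' => h.2.1 h'.1), add_zero]
  have p1 : prj (fun y => ¬ U y ∧ ¬ W y) (v0 + v1) = v1 := by
    rw [map_add, prj_eq_self (h1.mono fun y h => h.2),
      prj_eq_zero h0 (fun y h h' => h'.1 h.2.1), zero_add]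
  simp only [stepD, LinearMap.sub_apply, LinearMap.add_apply, LinearMap.comp_apply, p0, p1]
  rw [prj_eq_self (a1.mono fun y h => h.2), prj_eq_self (a6.mono fun y h => h.2)]

/-- The kept basis elements. -/
def keptP (U W : X → Prop) (y : X) : Prop := U y ↔ W y

theorem kept_split (v : X →₀ S) (hv : SupOn (fun y => A y ∧ keptP U W y) v) :
    ∃ v0 v1, v = v0 + v1 ∧ SupOn (fun y => A y ∧ U y ∧ W y) v0 ∧
      SupOn (fun y => A y ∧ ¬ U y ∧ ¬ W y) v1 := by
  refine ⟨prj (fun y => U y ∧ W y) v, prj (fun y => ¬ U y ∧ ¬ W y) v, ?_,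
    (hv.prj _).mono fun y h => ⟨h.1.1, h.2⟩, (hv.prj _).mono fun y h => ⟨h.1.1, h.2⟩⟩
  ext y
  rw [Finsupp.add_apply, prj_apply, prj_apply]
  by_cases h0 : v y = 0
  · simp [h0]
  · have := (hv y h0).2
    unfold keptP at this
    by_cases hU : U y <;> by_cases hW : W y <;> simp_all

theorem StepHyp.pres (H : StepHyp D deg g A U W) (v : X →₀ S)
    (hv : SupOn (fun y => A y ∧ keptP U W y) v) :
    SupOn (fun y => A y ∧ keptP U W y) (stepD D deg g U W v) := by
  obtain ⟨v0, v1, rfl, h0, h1⟩ := kept_split v hv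
  obtain ⟨e, a1, a2, a3, a4⟩ := H.analysis v0 v1 h0 h1
  rw [e]
  refine ((a1.mono ?_).add (a2.mono ?_)).sub ((a3.prj _).mono ?_) <;>
  · intro y h
    unfold keptP
    tauto

theorem StepHyp.split (H : StepHyp D deg g A U W) (w : X →₀ S)
    (hw : SupOn (fun y => g ≤ deg y) w) :
    w = prj U w + prj W w + prj (fun y => ¬ U y ∧ ¬ W y) w := by
  ext y
  simp only [Finsupp.add_apply, prj_apply]
  by_cases h0 : w y = 0
  · simp [h0]
  · have h1 := hw y h0
    have := H.both y
    by_cases hU : U y <;> by_cases hW : W y <;> simp [hU, hW]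
    have := this hU hW
    omega

theorem StepHyp.sq' (H : StepHyp D deg g A U W) (v : X →₀ S)
    (hv : SupOn (fun y => A y ∧ keptP U W y) v) :
    stepD D deg g U W (stepD D deg g U W v) = 0 := by
  obtain ⟨v0, v1, rfl, h0, h1⟩ := kept_split v hv
  obtain ⟨e, a1, a2, a3, a4⟩ := H.analysis v0 v1 h0 h1
  have hDw : D (D v1) = 0 := H.sq _ (h1.mono fun y h => h.1)
  set w := D v1 with hw
  rw [e, sub_eq_add_neg]
  obtain ⟨e', -, -, -, -⟩ := H.analysis
    (D v0 + D (prj (fun y => deg y = g ∧ U y) w)) (-prj (fun y => ¬ U y ∧ ¬ W y) w)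
    (a1.add a2) ((a3.prj _).neg.mono fun y h => h)
  rw [e']
  have d1 : D (D v0 + D (prj (fun y => deg y = g ∧ U y) w)) = 0 := by
    rw [map_add, H.sq _ (h0.mono fun y h => h.1), H.sq _ (a3.prj' _), add_zero]
  have hs := H.split w a4
  have hU : SupOn (fun y => A y ∧ U y) (D (prj U w)) := H.presU _ (a3.prj _)
  have hW : SupOn (fun y => A y ∧ W y) (D (prj W w)) := H.presW _ (a3.prj _)
  have d2 : D (-prj (fun y => ¬ U y ∧ ¬ W y) w) = D (prj U w) + D (prj W w) := by
    have : -prj (fun y => ¬ U y ∧ ¬ W y) w = prj U w + prj W w - w := by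
      calc -prj (fun y => ¬ U y ∧ ¬ W y) w = prj U w + prj W w -
            (prj U w + prj W w + prj (fun y => ¬ U y ∧ ¬ W y) w) := by abel
        _ = _ := by rw [← hs]
    rw [this, map_sub, hDw, sub_zero, map_add]
  have p1 : prj (fun y => ¬ U y ∧ ¬ W y) (D (prj U w) + D (prj W w)) = 0 := by
    rw [map_add, prj_eq_zero hU (fun y h h' => h'.1 h.2),
      prj_eq_zero hW (fun y h h' => h'.2 h.2), add_zero]
  have p2 : prj (fun y => deg y = g ∧ U y) (D (prj W w)) = 0 :=
    prj_eq_zero hW (fun y h h' => by have := H.both y h'.2 h.2; omega)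
  have p3 : prj (fun y => deg y = g ∧ U y) (D (prj U w)) =
      prj (fun y => deg y = g) (D (prj (fun y => g < deg y) (prj U w))) := by
    have e1 : prj U w = prj (fun y => deg y ≤ g) (prj U w) +
        prj (fun y => g < deg y) (prj U w) := by
      ext y
      simp only [Finsupp.add_apply, prj_apply]
      rcases le_or_gt (deg y) g with h | h
      · simp [h, not_lt.2 h]
      · simp [h, not_le.2 h]
    have e2 : prj (fun y => deg y = g ∧ U y) (D (prj U w)) =
        prj (fun y => deg y = g) (D (prj U w)) := by
      ext y
      simp only [prj_apply]
      by_cases h0 : D (prj U w) y = 0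
      · simp [h0]
      · simp [(hU y h0).2]
    rw [e2]
    conv_lhs => rw [e1, map_add, map_add]
    rw [prj_eq_zero (H.lt _ (supOn_prj _ _)) (fun y h h' => by omega), zero_add]
  rw [d1, d2, p1, map_add (prj _), p2, add_zero, p3, H.mid, zero_add, sub_zero]
  · exact H.gt _ (supOn_prj _ _)
  · exact H.sq _ ((a3.prj' _).prj' _)

theorem StepHyp.torsion (H : StepHyp D deg g A U W) (x : S)
    (tA : ∀ v, SupOn A v → D v = 0 → ∃ (k : ℕ) (u : X →₀ S), SupOn A u ∧ x ^ k • v = D u)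
    (tU : ∀ v, SupOn (fun y => A y ∧ U y) v → D v = 0 →
      ∃ (k : ℕ) (u : X →₀ S), SupOn (fun y => A y ∧ U y) u ∧ x ^ k • v = D u)
    (tW : ∀ v, SupOn (fun y => A y ∧ W y) v → D v = 0 →
      ∃ (k : ℕ) (u : X →₀ S), SupOn (fun y => A y ∧ W y) u ∧ x ^ k • v = D u)
    (v : X →₀ S) (hv : SupOn (fun y => A y ∧ keptP U W y) v) (hDv : stepD D deg g U W v = 0) :
    ∃ (k : ℕ) (u : X →₀ S), SupOn (fun y => A y ∧ keptP U W y) u ∧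
      x ^ k • v = stepD D deg g U W u := by
  obtain ⟨v0, v1, rfl, h0, h1⟩ := kept_split v hv
  obtain ⟨e, a1, a2, a3, a4⟩ := H.analysis v0 v1 h0 h1
  have hDw : D (D v1) = 0 := H.sq _ (h1.mono fun y h => h.1)
  have hwdef : D v1 = D v1 := rfl
  generalize hw : D v1 = w at *
  rw [e] at hDv
  -- the two components of the cycle condition
  have a5 : D v0 + D (prj (fun y => deg y = g ∧ U y) w) = prj (fun y => ¬ U y ∧ ¬ W y) w :=
    sub_eq_zero.1 hDv
  have a6 : prj (fun y => ¬ U y ∧ ¬ W y) w = 0 := by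
    refine eq_zero_of_supOn (supOn_prj _ _) (T' := fun y => A y ∧ U y ∧ W y) ?_
      (fun y h h' => h.1 h'.2.1)
    rw [← a5]; exact a1.add a2
  rw [a6] at a5
  have hs := H.split w a4
  rw [a6, add_zero] at hs
  have hU : SupOn (fun y => A y ∧ U y) (prj U w) := a3.prj _
  have hW : SupOn (fun y => A y ∧ W y) (prj W w) := a3.prj _
  have hUW : D (prj U w) + D (prj W w) = 0 := by rw [← map_add, ← hs, hDw]
  have hDU : D (prj U w) = D (prj (fun y => deg y = g ∧ U y) w) := by
    have e1 : prj U w = prj (fun y => deg y = g ∧ U y) w +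
        prj (fun y => g < deg y) (prj U w) := by
      ext y
      simp only [Finsupp.add_apply, prj_apply]
      by_cases hz : w y = 0
      · simp [hz]
      · rcases (a4 y hz).eq_or_lt with h | h
        · have h' := h.symm
          by_cases hu : U y <;> simp [h', hu]
        · simp [h, h.ne']
    have e2 : D (prj (fun y => g < deg y) (prj U w)) =
        D (prj U w) - D (prj (fun y => deg y = g ∧ U y) w) := by
      rw [← map_sub]
      congr 1
      rw [eq_sub_iff_add_eq', ← e1]
    have e3 : D (prj (fun y => g < deg y) (prj U w)) = 0 := by
      refine eq_zero_of_supOn (H.gt _ (supOn_prj _ _)) (T' := fun y => deg y < g) ?_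
        (fun y h h' => by omega)
      rw [e2]
      refine SupOn.sub ?_ (a2.mono fun y h => H.both y h.2.1 h.2.2)
      have b1 := H.presU _ hU
      have b2 := (H.presW _ hW).neg
      rw [← eq_neg_of_add_eq_zero_left hUW] at b2
      exact (b1.and b2).mono fun y h => H.both y h.1.2 h.2.2
    rw [e3] at e2
    exact (sub_eq_zero.1 e2.symm)
  have cU : D (v0 + prj U w) = 0 := by rw [map_add, hDU, a5]
  have cW : D (v0 - prj W w) = 0 := by
    rw [map_sub, sub_eq_add_neg, ← eq_neg_of_add_eq_zero_left hUW, hDU, a5]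
  obtain ⟨k1, γU, hγU, eU⟩ := tU _ ((h0.mono fun y h => ⟨h.1, h.2.1⟩).add hU) cU
  obtain ⟨k2, γW, hγW, eW⟩ := tW _ ((h0.mono fun y h => ⟨h.1, h.2.2⟩).sub hW) cW
  have eU' : x ^ (k1 + k2) • (v0 + prj U w) = D (x ^ k2 • γU) := by
    rw [map_smul, ← eU, smul_smul, ← pow_add, add_comm]
  have eW' : x ^ (k1 + k2) • (v0 - prj W w) = D (x ^ k1 • γW) := by
    rw [map_smul, ← eW, smul_smul, ← pow_add]
  replace hγU := hγU.smul (x ^ k2)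
  replace hγW := hγW.smul (x ^ k1)
  generalize x ^ k2 • γU = γU at *
  generalize x ^ k1 • γW = γW at *
  generalize k1 + k2 = k at *
  have cA : D (x ^ k • v1 - γU + γW) = 0 := by
    rw [map_add, map_sub, ← eU', ← eW', map_smul, hw]
    conv_lhs => rw [hs]
    rw [smul_add, smul_add, smul_sub, ← hs]
    abel
  obtain ⟨m, ζ, hζ, eζ⟩ := tA _ (((h1.mono fun y h => h.1).smul _ |>.sub
    (hγU.mono fun y h => h.1)).add (hγW.mono fun y h => h.1)) cA
  set ζU := prj U ζ with hζU
  set ζW := prj (fun y => W y ∧ ¬ U y) ζ with hζW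
  set ζq := prj (fun y => ¬ U y ∧ ¬ W y) ζ with hζq
  have sζ : ζ = ζU + ζW + ζq := by
    ext y
    simp only [hζU, hζW, hζq, Finsupp.add_apply, prj_apply]
    by_cases hU : U y <;> by_cases hW : W y <;> simp [hU, hW]
  have gU : SupOn (fun y => A y ∧ U y) (x ^ m • γU + D ζU) :=
    (hγU.smul _).add (H.presU _ (hζ.prj _))
  have gW : SupOn (fun y => A y ∧ W y) (x ^ m • γW - D ζW) :=
    (hγW.smul _).sub (H.presW _ ((hζ.prj _).mono fun y h => ⟨h.1, h.2.1⟩))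
  have key : x ^ (m + k) • v1 = (x ^ m • γU + D ζU) - (x ^ m • γW - D ζW) + D ζq := by
    have : D ζ = D ζU + D ζW + D ζq := by
      conv_lhs => rw [sζ]
      rw [map_add, map_add]
    rw [this, smul_add, smul_sub, smul_smul, ← pow_add] at eζ
    have e3 : x ^ (m + k) • v1 = D ζU + D ζW + D ζq + x ^ m • γU - x ^ m • γW := by
      rw [← eζ]; abel
    rw [e3]; abel
  have DgU : D (x ^ m • γU + D ζU) = x ^ (m + k) • (v0 + prj U w) := by
    rw [map_add, map_smul, ← eU', H.sq _ (hζ.prj' _), add_zero, smul_smul, pow_add]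
  generalize x ^ m • γU + D ζU = γ at *
  generalize x ^ m • γW - D ζW = γ' at *
  generalize m + k = r at *
  have hζq' : SupOn (fun y => A y ∧ ¬ U y ∧ ¬ W y) ζq := hζ.prj _
  have hDζq : SupOn (fun y => g ≤ deg y) (D ζq) :=
    H.gt _ (hζq'.mono fun y h => H.none y h.2.1 h.2.2)
  have hlow : prj (fun y => deg y < g) γ = prj (fun y => deg y < g) γ' := by
    have := congrArg (prj fun y => deg y < g) key
    rw [map_add, map_sub, prj_eq_zero hDζq (fun y h h' => by omega), add_zero,
      prj_eq_zero (h1.smul _) (fun y h h' => by have := H.none y h.2.1 h.2.2; omega)] at this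
    exact (sub_eq_zero.1 this.symm)
  have hu0 : SupOn (fun y => A y ∧ U y ∧ W y) (prj (fun y => deg y < g) γ) := by
    have b1 := gU.prj' (fun y => deg y < g)
    have b2 := gW.prj' (fun y => deg y < g)
    rw [← hlow] at b2
    exact (b1.and b2).mono fun y h => ⟨h.1.1, h.1.2, h.2.2⟩
  have kU : ∀ y, U y → keptP U W y → W y := fun y h h' => h'.1 h
  refine ⟨r, prj (fun y => deg y < g) γ + (-ζq), ?_, ?_⟩
  · refine (hu0.mono ?_).add (hζq'.neg.mono ?_) <;>
    · intro y h
      unfold keptP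
      tauto
  obtain ⟨e', -, -, -, -⟩ := H.analysis (prj (fun y => deg y < g) γ) (-ζq) hu0 hζq'.neg
  rw [e', map_neg D ζq, map_neg, map_neg, map_neg, sub_neg_eq_add]
  have f1 : prj (fun y => ¬ U y ∧ ¬ W y) (D ζq) = x ^ r • v1 := by
    have := congrArg (prj fun y => ¬ U y ∧ ¬ W y) key
    rw [map_add, map_sub, prj_eq_zero gU (fun y h h' => h'.1 h.2),
      prj_eq_zero gW (fun y h h' => h'.2 h.2), sub_zero, zero_add,
      prj_eq_self ((h1.smul _).mono fun y h => h.2)] at this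
    exact this.symm
  have f2 : prj (fun y => deg y = g ∧ U y) (D ζq) = - prj (fun y => deg y = g) γ := by
    have := congrArg (prj fun y => deg y = g ∧ U y) key
    rw [map_add, map_sub, prj_eq_zero gW
        (fun y h h' => by have := H.both y h'.2 h.2; omega), sub_zero,
      prj_eq_zero (h1.smul _) (fun y h h' => h.2.1 h'.2)] at this
    have e2 : prj (fun y => deg y = g ∧ U y) γ = prj (fun y => deg y = g) γ := by
      ext y
      simp only [prj_apply]
      by_cases hz : γ y = 0
      · simp [hz]
      · simp [(gU y hz).2]
    rw [e2] at this
    exact (eq_neg_of_add_eq_zero_right this.symm)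
  rw [f1, f2, map_neg, neg_neg, smul_add]
  congr 1
  have s3 : γ = prj (fun y => deg y < g) γ + prj (fun y => deg y = g) γ +
      prj (fun y => g < deg y) γ := by
    ext y
    simp only [Finsupp.add_apply, prj_apply]
    rcases lt_trichotomy (deg y) g with h | h | h
    · simp [h, h.ne, h.not_gt]
    · simp [h]
    · simp [h, h.ne', h.not_gt]
  have t := congrArg (prj fun y => deg y < g) DgU
  rw [s3, map_add, map_add, map_add, prj_eq_zero (H.gt _ (supOn_prj _ _)) (fun y h h' => by omega),
    add_zero, map_smul, map_add (prj _) v0, prj_eq_self (h0.mono fun y h => H.both y h.2.1 h.2.2),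
    prj_eq_zero (a4.prj' _) (fun y h h' => by omega), add_zero] at t
  rw [← t, ← map_add, prj_eq_self]
  apply H.lt
  refine SupOn.add ((supOn_prj _ _).mono fun y h => h.le) ((supOn_prj _ _).mono fun y h => h.le)

end StepSec

section StageSec
variable {K : Type} [Field K] {n : ℕ} {X ι : Type} [Fintype ι] [DecidableEq ι]

/-- The conditions that can be imposed in one of the directions. -/
inductive Cnd where
  | plus | minus | all | kept

/-- exponent in direction `j` is nonnegative -/
def dirU (ex : X → ι → ℤ) (j : ι) (y : X) : Prop := 0 ≤ ex y j

/-- exponent in direction `j` is small -/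
def dirW (deg : X → ℕ) (ex : X → ι → ℤ) (gap : ι → ℕ) (j : ι) (y : X) : Prop :=
  ex y j < (gap j : ℤ) - deg y

def condP (deg : X → ℕ) (ex : X → ι → ℤ) (gap : ι → ℕ) (j : ι) : Cnd → X → Prop
  | .plus => dirU ex j
  | .minus => dirW deg ex gap j
  | .all => fun _ => True
  | .kept => keptP (dirU ex j) (dirW deg ex gap j)

def chartP (deg : X → ℕ) (ex : X → ι → ℤ) (gap : ι → ℕ) (ε : ι → Cnd) (y : X) : Prop :=
  ∀ j, condP deg ex gap j (ε j) y

/-- `v` is homogeneous of total degree `δ`. -/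
def GrOn (deg : X → ℕ) (δ : ℕ) (v : X →₀ MvPolynomial (Fin n) K) : Prop :=
  ∀ y, (v y).IsHomogeneous (δ - deg y) ∧ (δ < deg y → v y = 0)

theorem GrOn.add {deg : X → ℕ} {δ : ℕ} {v w : X →₀ MvPolynomial (Fin n) K}
    (hv : GrOn deg δ v) (hw : GrOn deg δ w) : GrOn deg δ (v + w) := fun y =>
  ⟨(hv y).1.add (hw y).1, fun h => by simp [(hv y).2 h, (hw y).2 h]⟩

theorem GrOn.sub {deg : X → ℕ} {δ : ℕ} {v w : X →₀ MvPolynomial (Fin n) K}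
    (hv : GrOn deg δ v) (hw : GrOn deg δ w) : GrOn deg δ (v - w) := fun y =>
  ⟨(hv y).1.sub (hw y).1, fun h => by simp [(hv y).2 h, (hw y).2 h]⟩

theorem GrOn.prj {deg : X → ℕ} {δ : ℕ} {v : X →₀ MvPolynomial (Fin n) K}
    (hv : GrOn deg δ v) (T : X → Prop) : GrOn deg δ (prj T v) := by
  intro y
  rw [prj_apply]
  by_cases h : T y
  · simpa [h] using hv y
  · simp [h, MvPolynomial.isHomogeneous_zero]

structure Stage (deg : X → ℕ) (ex : X → ι → ℤ) (gap : ι → ℕ)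
    (xs : Set (MvPolynomial (Fin n) K)) (J : Finset ι)
    (D : (X →₀ MvPolynomial (Fin n) K) →ₗ[MvPolynomial (Fin n) K]
      (X →₀ MvPolynomial (Fin n) K)) : Prop where
  pres : ∀ ε : ι → Cnd, (∀ j, ε j = Cnd.kept ↔ j ∈ J) → ∀ v,
    SupOn (chartP deg ex gap ε) v → SupOn (chartP deg ex gap ε) (D v)
  sq : ∀ ε : ι → Cnd, (∀ j, ε j = Cnd.kept ↔ j ∈ J) → ∀ v,
    SupOn (chartP deg ex gap ε) v → D (D v) = 0
  tors : ∀ ε : ι → Cnd, (∀ j, ε j = Cnd.kept ↔ j ∈ J) → ∀ x ∈ xs, ∀ v,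
    SupOn (chartP deg ex gap ε) v → D v = 0 →
      ∃ (k : ℕ) (u : X →₀ MvPolynomial (Fin n) K), SupOn (chartP deg ex gap ε) u ∧ x ^ k • v = D u
  lt : ∀ m v, SupOn (fun y => deg y ≤ m) v → SupOn (fun y => deg y < m) (D v)
  gt : ∀ m, (∀ j ∈ J, gap j ≠ m) → ∀ v,
    SupOn (fun y => m < deg y) v → SupOn (fun y => m ≤ deg y) (D v)
  hom : ∀ δ v, GrOn deg δ v → GrOn deg δ (D v)

theorem chartP_update (deg : X → ℕ) (ex : X → ι → ℤ) (gap : ι → ℕ) (ε : ι → Cnd) (j : ι)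
    (a : Cnd) :
    chartP deg ex gap (Function.update ε j a) =
      fun y => (∀ i, i ≠ j → condP deg ex gap i (ε i) y) ∧ condP deg ex gap j a y := by
  funext y
  apply propext
  constructor
  · intro h
    refine ⟨fun i hi => ?_, ?_⟩
    · have := h i
      rwa [Function.update_of_ne hi] at this
    · have := h j
      rwa [Function.update_self] at this
  · rintro ⟨h1, h2⟩ i
    by_cases hi : i = j
    · subst hi; rwa [Function.update_self]
    · rw [Function.update_of_ne hi]; exact h1 i hi

theorem Stage.step {deg : X → ℕ} {ex : X → ι → ℤ} {gap : ι → ℕ}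
    {xs : Set (MvPolynomial (Fin n) K)} {J : Finset ι}
    {D : (X →₀ MvPolynomial (Fin n) K) →ₗ[MvPolynomial (Fin n) K]
      (X →₀ MvPolynomial (Fin n) K)} (H : Stage deg ex gap xs J D)
    (hgap : Function.Injective gap) (j : ι) (hj : j ∉ J) :
    Stage deg ex gap xs (insert j J)
      (stepD D deg (gap j) (dirU ex j) (dirW deg ex gap j)) := by
  have upd : ∀ ε : ι → Cnd, (∀ i, ε i = Cnd.kept ↔ i ∈ insert j J) → ∀ a, a ≠ Cnd.kept →
      ∀ i, Function.update ε j a i = Cnd.kept ↔ i ∈ J := by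
    intro ε hε a ha i
    by_cases hi : i = j
    · subst hi; simp [ha, hj]
    · rw [Function.update_of_ne hi, hε]; simp [hi]
  have eA : ∀ ε : ι → Cnd, chartP deg ex gap (Function.update ε j Cnd.all) =
      fun y => ∀ i, i ≠ j → condP deg ex gap i (ε i) y := by
    intro ε; rw [chartP_update]; simp [condP]
  have eK : ∀ ε : ι → Cnd, (∀ i, ε i = Cnd.kept ↔ i ∈ insert j J) → chartP deg ex gap ε =
      fun y => (∀ i, i ≠ j → condP deg ex gap i (ε i) y) ∧
        keptP (dirU ex j) (dirW deg ex gap j) y := by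
    intro ε hε
    have : ε = Function.update ε j Cnd.kept := by
      rw [← (hε j).2 (by simp), Function.update_eq_self]
    conv_lhs => rw [this, chartP_update]
    rfl
  have SH : ∀ ε : ι → Cnd, (∀ i, ε i = Cnd.kept ↔ i ∈ insert j J) →
      StepHyp D deg (gap j) (fun y => ∀ i, i ≠ j → condP deg ex gap i (ε i) y)
        (dirU ex j) (dirW deg ex gap j) := by
    intro ε hε
    refine ⟨?_, ?_, ?_, H.lt _, H.gt _ ?_, ?_, ?_, ?_⟩
    · have := H.pres _ (upd ε hε Cnd.all (by simp))
      rwa [eA] at this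
    · have := H.pres _ (upd ε hε Cnd.plus (by simp))
      rwa [chartP_update] at this
    · have := H.pres _ (upd ε hε Cnd.minus (by simp))
      rwa [chartP_update] at this
    · intro i hi h
      exact hj (hgap h ▸ hi)
    · have := H.sq _ (upd ε hε Cnd.all (by simp))
      rwa [eA] at this
    · intro y h1 h2
      unfold dirU at h1; unfold dirW at h2; omega
    · intro y h1 h2
      unfold dirU at h1; unfold dirW at h2; omega
  refine ⟨?_, ?_, ?_, ?_, ?_, ?_⟩
  · intro ε hε
    rw [eK ε hε]
    exact (SH ε hε).pres
  · intro ε hε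
    rw [eK ε hε]
    exact (SH ε hε).sq'
  · intro ε hε x hx
    rw [eK ε hε]
    apply (SH ε hε).torsion x
    · have := H.tors _ (upd ε hε Cnd.all (by simp)) x hx
      rwa [eA] at this
    · have := H.tors _ (upd ε hε Cnd.plus (by simp)) x hx
      rwa [chartP_update] at this
    · have := H.tors _ (upd ε hε Cnd.minus (by simp)) x hx
      rwa [chartP_update] at this
  · intro m v hv
    simp only [stepD, LinearMap.sub_apply, LinearMap.add_apply, LinearMap.comp_apply]
    refine SupOn.sub (SupOn.add ?_ ?_) ?_
    · exact (H.lt _ _ (hv.prj' _)).prj' _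
    · refine (H.lt _ _ ?_).prj' _
      exact ((H.lt _ _ (hv.prj' _)).prj' _).mono fun y h => le_of_lt h
    · exact (H.lt _ _ (hv.prj' _)).prj' _
  · intro m hm v hv
    have hm1 : ∀ i ∈ J, gap i ≠ m := fun i hi => hm i (by simp [hi])
    have hm2 : gap j ≠ m := hm j (by simp)
    simp only [stepD, LinearMap.sub_apply, LinearMap.add_apply, LinearMap.comp_apply]
    refine SupOn.sub (SupOn.add ?_ ?_) ?_
    · exact (H.gt _ hm1 _ (hv.prj' _)).prj' _
    · refine (H.gt _ hm1 _ ?_).prj' _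
      exact ((H.gt _ hm1 _ (hv.prj' _)).prj _).mono fun y h => by omega
    · exact (H.gt _ hm1 _ (hv.prj' _)).prj' _
  · intro δ v hv
    simp only [stepD, LinearMap.sub_apply, LinearMap.add_apply, LinearMap.comp_apply]
    refine GrOn.sub (GrOn.add ?_ ?_) ?_
    · exact (H.hom _ _ (hv.prj _)).prj _
    · exact (H.hom _ _ ((H.hom _ _ (hv.prj _)).prj _)).prj _
    · exact (H.hom _ _ (hv.prj _)).prj _

theorem Stage.exists_univ {deg : X → ℕ} {ex : X → ι → ℤ} {gap : ι → ℕ}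
    {xs : Set (MvPolynomial (Fin n) K)} (hgap : Function.Injective gap)
    (h0 : ∃ D, Stage deg ex gap xs ∅ D) : ∃ D, Stage deg ex gap xs Finset.univ D := by
  have : ∀ J : Finset ι, ∃ D, Stage deg ex gap xs J D := by
    intro J
    induction J using Finset.induction_on with
    | empty => exact h0
    | insert j J hj ih =>
      obtain ⟨D, hD⟩ := ih
      exact ⟨_, hD.step hgap j hj⟩
  exact this _

end StageSec

section KoszulSec
variable {S : Type} [CommRing S] {N : ℕ} {ι : Type}

/-- Basis of the ambient free module. -/
abbrev KX (N : ℕ) (ι : Type) : Type := Finset (Fin N) × (ι → ℤ)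

abbrev KPhi (S : Type) [CommRing S] (N : ℕ) (ι : Type) : Type := KX N ι →₀ S

/-- The Koszul sign. -/
def ksgn (S : Type) [CommRing S] (k : Fin N) (b : Finset (Fin N)) : S :=
  (-1) ^ (b.filter (fun i => i < k)).card

theorem ksgn_insert (k l : Fin N) (b : Finset (Fin N)) (h : l ∉ b) :
    ksgn S k (insert l b) = if l < k then - ksgn S k b else ksgn S k b := by
  unfold ksgn
  rw [Finset.filter_insert]
  split_ifs with h1
  · rw [Finset.card_insert_of_notMem (by simp [h]), pow_succ]; ring
  · rfl

theorem ksgn_erase (k l : Fin N) (b : Finset (Fin N)) (h : l ∈ b) :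
    ksgn S k (b.erase l) = if l < k then - ksgn S k b else ksgn S k b := by
  have := ksgn_insert (S := S) k l (b.erase l) (by simp)
  rw [Finset.insert_erase h] at this
  split_ifs with h1
  · simp [this, h1]
  · simp [this, h1]

theorem ksgn_mul_self (k : Fin N) (b : Finset (Fin N)) : ksgn S k b * ksgn S k b = 1 := by
  unfold ksgn
  rw [← mul_pow]; simp

/-- Shift of exponents. -/
def kshift (S : Type) [CommRing S] (N : ℕ) {ι : Type} (μ : ι → ℤ) : Module.End S (KPhi S N ι) :=
  Finsupp.linearCombination S (fun y => Finsupp.single (y.1, y.2 + μ) (1 : S))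

/-- Contraction. -/
def kdel (S : Type) [CommRing S] {N : ℕ} (ι : Type) (k : Fin N) : Module.End S (KPhi S N ι) :=
  Finsupp.linearCombination S (fun y => if k ∈ y.1 then
    Finsupp.single (y.1.erase k, y.2) (ksgn S k y.1) else 0)

/-- Wedge. -/
def kwed (S : Type) [CommRing S] {N : ℕ} (ι : Type) (k : Fin N) : Module.End S (KPhi S N ι) :=
  Finsupp.linearCombination S (fun y => if k ∈ y.1 then 0 else
    Finsupp.single (insert k y.1, y.2) (ksgn S k y.1))

theorem kshift_single (μ : ι → ℤ) (y : KX N ι) (r : S) :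
    kshift S N μ (Finsupp.single y r) = Finsupp.single (y.1, y.2 + μ) r := by
  simp [kshift]

theorem kdel_single (k : Fin N) (y : KX N ι) (r : S) :
    kdel S ι k (Finsupp.single y r) = if k ∈ y.1 then
      Finsupp.single (y.1.erase k, y.2) (r * ksgn S k y.1) else 0 := by
  simp only [kdel, Finsupp.linearCombination_single]
  split_ifs <;> simp

theorem kwed_single (k : Fin N) (y : KX N ι) (r : S) :
    kwed S ι k (Finsupp.single y r) = if k ∈ y.1 then 0 else
      Finsupp.single (insert k y.1, y.2) (r * ksgn S k y.1) := by
  simp only [kwed, Finsupp.linearCombination_single]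
  split_ifs <;> simp

theorem kshift_add (μ ν : ι → ℤ) : kshift S N (μ + ν) = kshift S N μ * kshift S N ν := by
  refine Finsupp.lhom_ext fun y r => ?_
  simp only [Module.End.mul_apply, kshift_single]
  rw [add_assoc, add_comm ν]

theorem kshift_zero : kshift S N (0 : ι → ℤ) = 1 := by
  refine Finsupp.lhom_ext fun y r => ?_
  simp [-Finsupp.single_mul, kshift_single]

theorem kshift_kdel (μ : ι → ℤ) (k : Fin N) : Commute (kshift S N μ) (kdel S ι k) := by
  refine Finsupp.lhom_ext fun y r => ?_
  simp only [Module.End.mul_apply, kshift_single, kdel_single]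
  split_ifs <;> simp [-Finsupp.single_mul, kshift_single]

theorem kshift_kwed (μ : ι → ℤ) (k : Fin N) : Commute (kshift S N μ) (kwed S ι k) := by
  refine Finsupp.lhom_ext fun y r => ?_
  simp only [Module.End.mul_apply, kshift_single, kwed_single]
  split_ifs <;> simp [-Finsupp.single_mul, kshift_single]

theorem kdel_sq (k : Fin N) : kdel S ι k * kdel S ι k = 0 := by
  refine Finsupp.lhom_ext fun y r => ?_
  simp only [Module.End.mul_apply, kdel_single]
  split_ifs <;> simp [-Finsupp.single_mul, kdel_single]

theorem kdel_anti (k l : Fin N) : kdel S ι k * kdel S ι l = - (kdel S ι l * kdel S ι k) := by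
  by_cases hkl : k = l
  · subst hkl; rw [kdel_sq]; exact (neg_zero (G := Module.End S (KPhi S N ι))).symm
  refine Finsupp.lhom_ext fun y r => ?_
  simp only [Module.End.mul_apply, LinearMap.neg_apply, kdel_single]
  by_cases h1 : k ∈ y.1 <;> by_cases h2 : l ∈ y.1 <;> simp [-Finsupp.single_mul, h1, h2, kdel_single, hkl, Ne.symm hkl]
  rw [← Finsupp.single_neg, Finset.erase_right_comm, ksgn_erase _ _ _ h1, ksgn_erase _ _ _ h2]
  congr 1
  rcases lt_trichotomy k l with h | h | h
  · simp [h, h.not_gt]; ring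
  · exact absurd h hkl
  · simp [h, h.not_gt]; ring

theorem kdel_kwed (k l : Fin N) : kdel S ι k * kwed S ι l + kwed S ι l * kdel S ι k =
    if k = l then 1 else 0 := by
  refine Finsupp.lhom_ext fun y r => ?_
  by_cases hkl : k = l
  · subst hkl
    simp only [Module.End.mul_apply, LinearMap.add_apply, kdel_single, kwed_single]
    by_cases h1 : k ∈ y.1
    · simp [-Finsupp.single_mul, h1, kwed_single, ksgn_erase, mul_assoc, ksgn_mul_self]
    · simp [-Finsupp.single_mul, h1, kdel_single, ksgn_insert, mul_assoc, ksgn_mul_self]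
  simp only [Module.End.mul_apply, LinearMap.add_apply, kdel_single, kwed_single]
  by_cases h1 : k ∈ y.1 <;> by_cases h2 : l ∈ y.1 <;>
    simp [-Finsupp.single_mul, h1, h2, kdel_single, kwed_single, hkl, Ne.symm hkl]
  rw [Finset.erase_insert_of_ne (Ne.symm hkl), ← Finsupp.single_add, ksgn_erase _ _ _ h1,
    ksgn_insert _ _ _ h2, Finsupp.single_eq_zero]
  rcases lt_trichotomy k l with h | h | h
  · simp [h, h.not_gt]; ring
  · exact absurd h hkl
  · simp [h, h.not_gt]; ring

end KoszulSec

section OpRSec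
variable {K : Type} [Field K] {n : ℕ} {X : Type}

/-- `A` is a matrix whose entries are homogeneous of degree `s` and are supported on `R`. -/
def OpR (R : X → X → Prop) (s : ℕ) (A : Module.End (MvPolynomial (Fin n) K)
    (X →₀ MvPolynomial (Fin n) K)) : Prop :=
  ∀ y y', (A (Finsupp.single y 1) y').IsHomogeneous s ∧ (A (Finsupp.single y 1) y' ≠ 0 → R y y')

theorem op_apply (A : Module.End (MvPolynomial (Fin n) K)
    (X →₀ MvPolynomial (Fin n) K)) (v : X →₀ MvPolynomial (Fin n) K) (y' : X) :
    A v y' = ∑ y ∈ v.support, v y * A (Finsupp.single y 1) y' := by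
  conv_lhs => rw [← Finsupp.sum_single v, Finsupp.sum, map_sum]
  rw [Finsupp.finsetSum_apply]
  refine Finset.sum_congr rfl fun y _ => ?_
  rw [← mul_one (v y), ← smul_eq_mul, ← Finsupp.smul_single, map_smul]
  simp

theorem OpR.mono {R R' : X → X → Prop} {s : ℕ} {A : Module.End (MvPolynomial (Fin n) K)
    (X →₀ MvPolynomial (Fin n) K)} (h : OpR R s A) (hR : ∀ y y', R y y' → R' y y') :
    OpR R' s A := fun y y' => ⟨(h y y').1, fun h' => hR _ _ ((h y y').2 h')⟩

theorem OpR.zero {R : X → X → Prop} {s : ℕ} : OpR R s (0 : Module.End (MvPolynomial (Fin n) K)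
    (X →₀ MvPolynomial (Fin n) K)) := fun y y' =>
  ⟨by simpa using MvPolynomial.isHomogeneous_zero _ _ _, by simp⟩

theorem OpR.add {R : X → X → Prop} {s : ℕ} {A B : Module.End (MvPolynomial (Fin n) K)
    (X →₀ MvPolynomial (Fin n) K)} (hA : OpR R s A) (hB : OpR R s B) : OpR R s (A + B) := by
  intro y y'
  refine ⟨by simpa using (hA y y').1.add (hB y y').1, fun h => ?_⟩
  by_contra h'
  have h1 : A (Finsupp.single y 1) y' = 0 := by by_contra h2; exact h' ((hA y y').2 h2)
  have h2 : B (Finsupp.single y 1) y' = 0 := by by_contra h2; exact h' ((hB y y').2 h2)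
  exact h (by simp [h1, h2])

theorem OpR.sum {R : X → X → Prop} {s : ℕ} {κ : Type} (t : Finset κ)
    {A : κ → Module.End (MvPolynomial (Fin n) K)
    (X →₀ MvPolynomial (Fin n) K)} (hA : ∀ k, OpR R s (A k)) : OpR R s (∑ k ∈ t, A k) := by
  classical
  induction t using Finset.induction_on with
  | empty => simpa using OpR.zero
  | insert a t ha ih => rw [Finset.sum_insert ha]; exact (hA a).add ih

theorem OpR.mul {R R' : X → X → Prop} {s t : ℕ} {A B : Module.End (MvPolynomial (Fin n) K)
    (X →₀ MvPolynomial (Fin n) K)} (hA : OpR R s A) (hB : OpR R' t B) :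
    OpR (fun y z => ∃ w, R' y w ∧ R w z) (s + t) (A * B) := by
  intro y z
  rw [Module.End.mul_apply, op_apply]
  constructor
  · refine MvPolynomial.IsHomogeneous.sum _ _ _ fun w _ => ?_
    rw [add_comm]
    exact (hB y w).1.mul (hA w z).1
  · intro h
    obtain ⟨w, _, h2⟩ := Finset.exists_ne_zero_of_sum_ne_zero h
    exact ⟨w, (hB y w).2 (left_ne_zero_of_mul h2), (hA w z).2 (right_ne_zero_of_mul h2)⟩

theorem OpR.sup {R : X → X → Prop} {s : ℕ} {A : Module.End (MvPolynomial (Fin n) K)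
    (X →₀ MvPolynomial (Fin n) K)} (hA : OpR R s A) {T T' : X → Prop}
    (h : ∀ y y', R y y' → T y → T' y') (v : X →₀ MvPolynomial (Fin n) K) (hv : SupOn T v) :
    SupOn T' (A v) := by
  intro z hz
  rw [op_apply] at hz
  obtain ⟨w, _, h2⟩ := Finset.exists_ne_zero_of_sum_ne_zero hz
  exact h w z ((hA w z).2 (right_ne_zero_of_mul h2)) (hv w (left_ne_zero_of_mul h2))

theorem OpR.hom {R : X → X → Prop} {A : Module.End (MvPolynomial (Fin n) K)
    (X →₀ MvPolynomial (Fin n) K)} (hA : OpR R 1 A) {deg : X → ℕ}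
    (h : ∀ y y', R y y' → deg y = deg y' + 1) (δ : ℕ) (v : X →₀ MvPolynomial (Fin n) K)
    (hv : GrOn deg δ v) : GrOn deg δ (A v) := by
  intro z
  have key : ∀ w, v w * A (Finsupp.single w 1) z ≠ 0 → deg w = deg z + 1 ∧ deg w ≤ δ := by
    intro w hw
    refine ⟨h _ _ ((hA w z).2 (right_ne_zero_of_mul hw)), ?_⟩
    by_contra h'
    exact left_ne_zero_of_mul hw ((hv w).2 (by omega))
  rw [op_apply]
  constructor
  · refine MvPolynomial.IsHomogeneous.sum _ _ _ fun w _ => ?_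
    by_cases hw : v w * A (Finsupp.single w 1) z = 0
    · rw [hw]; exact MvPolynomial.isHomogeneous_zero _ _ _
    · obtain ⟨h1, h2⟩ := key w hw
      have : δ - deg z = (δ - deg w) + 1 := by omega
      rw [this]
      exact (hv w).1.mul (hA w z).1
  · intro hz
    refine Finset.sum_eq_zero fun w _ => ?_
    by_contra hw
    have := key w hw
    omega

theorem OpR.of_single {R : X → X → Prop} {s : ℕ} {A : Module.End (MvPolynomial (Fin n) K)
    (X →₀ MvPolynomial (Fin n) K)}
    (h : ∀ y, A (Finsupp.single y 1) = 0 ∨ ∃ y' r, R y y' ∧ MvPolynomial.IsHomogeneous r s ∧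
      A (Finsupp.single y 1) = Finsupp.single y' r) : OpR R s A := by
  classical
  intro y z
  rcases h y with h0 | ⟨y', r, h1, h2, h3⟩
  · simp [h0, MvPolynomial.isHomogeneous_zero]
  · rw [h3, Finsupp.single_apply]
    split_ifs with h4
    · subst h4; exact ⟨h2, fun _ => h1⟩
    · simp [MvPolynomial.isHomogeneous_zero]

end OpRSec

section KoszulF
variable {S : Type} [CommRing S] {N : ℕ} {ι : Type} [DecidableEq ι]

/-- Coefficients of `(∑ x_k s^k) * ∏_{j ∈ L} (1 + t_j s)` as operators. -/
def kF (N : ℕ) (x : ℕ → S) : List ι → ℕ → Module.End S (KPhi S N ι)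
  | [], k => x k • 1
  | _ :: L, 0 => kF N x L 0
  | j :: L, k + 1 => kF N x L (k + 1) + kshift S N (Pi.single j 1) * kF N x L k

theorem kF_commute (x : ℕ → S) (A : Module.End S (KPhi S N ι))
    (hA : ∀ μ, Commute A (kshift S N μ)) (L : List ι) : ∀ k, Commute A (kF N x L k) := by
  induction L with
  | nil => intro k; exact (Commute.one_right A).smul_right (x k)
  | cons j L ih =>
    intro k
    cases k with
    | zero => exact ih 0
    | succ k => exact (ih _).add_right ((hA _).mul_right (ih _))

theorem kF_eq_zero (x : ℕ → S) (c : ℕ) (hx : ∀ k, c ≤ k → x k = 0) (L : List ι) :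
    ∀ k, c + L.length ≤ k → kF N x L k = 0 := by
  induction L with
  | nil => intro k hk; simp [kF, hx k (by simpa using hk)]
  | cons j L ih =>
    intro k hk
    simp only [List.length_cons] at hk
    cases k with
    | zero => omega
    | succ k => simp [kF, ih (k+1) (by omega), ih k (by omega)]

theorem kshift_comm (μ ν : ι → ℤ) : Commute (kshift S N μ) (kshift S N ν) := by
  unfold Commute SemiconjBy
  rw [← kshift_add, ← kshift_add, add_comm]

/-- The Koszul differential. -/
def kD (N : ℕ) (x : ℕ → S) (L : List ι) : Module.End S (KPhi S N ι) :=
  ∑ k : Fin N, kF N x L k * kdel S ι k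

theorem kD_sq (x : ℕ → S) (L : List ι) : kD N x L * kD N x L = 0 := by
  have e : ∀ k l : Fin N, kF N x L k * kdel S ι k * (kF N x L l * kdel S ι l) =
      kF N x L k * kF N x L l * (kdel S ι k * kdel S ι l) := by
    intro k l
    have := kF_commute x (kdel S ι k) (fun μ => (kshift_kdel μ k).symm) L l
    rw [mul_assoc, ← mul_assoc (kdel S ι k), this.eq]
    simp only [mul_assoc]
  have e2 : ∀ k l : Fin N, kF N x L k * kF N x L l = kF N x L l * kF N x L k := by
    intro k l
    exact kF_commute x _ (fun μ => (kF_commute x _ (fun ν => kshift_comm μ ν) L k).symm) L l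
  rw [kD, Finset.sum_mul_sum, ← Finset.sum_product']
  refine Finset.sum_involution (fun a _ => (a.2, a.1)) ?_ ?_ ?_ ?_
  · rintro ⟨k, l⟩ _
    simp only [e]
    rw [e2 l k, kdel_anti l k]
    rw [← mul_add]
    have : kdel S ι k * kdel S ι l + -(kdel S ι k * kdel S ι l) = 0 :=
      add_neg_cancel (G := Module.End S (KPhi S N ι)) _
    rw [this, mul_zero]
  · rintro ⟨k, l⟩ _ h h'
    simp only [Prod.mk.injEq] at h'
    apply h
    simp only [e]
    rw [h'.1, kdel_sq, mul_zero]
  · simp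
  · simp

theorem kD_homotopy (x : ℕ → S) (L : List ι) (μ : ι → ℤ) (k : Fin N) :
    kD N x L * (kshift S N μ * kwed S ι k) + (kshift S N μ * kwed S ι k) * kD N x L =
      kshift S N μ * kF N x L k := by
  have e : ∀ l : Fin N, kF N x L l * kdel S ι l * (kshift S N μ * kwed S ι k) +
      kshift S N μ * kwed S ι k * (kF N x L l * kdel S ι l) =
      if l = k then kshift S N μ * kF N x L l else 0 := by
    intro l
    have h1 : kF N x L l * kdel S ι l * (kshift S N μ * kwed S ι k) =
        kshift S N μ * kF N x L l * (kdel S ι l * kwed S ι k) := by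
      rw [mul_assoc, ← mul_assoc (kdel S ι l), ← (kshift_kdel μ l).eq, mul_assoc,
        ← mul_assoc, ← (kF_commute x _ (fun ν => kshift_comm μ ν) L l).eq]
    have h2 : kshift S N μ * kwed S ι k * (kF N x L l * kdel S ι l) =
        kshift S N μ * kF N x L l * (kwed S ι k * kdel S ι l) := by
      rw [mul_assoc, ← mul_assoc (kwed S ι k),
        (kF_commute x _ (fun μ => (kshift_kwed μ k).symm) L l).eq]
      simp only [mul_assoc]
    rw [h1, h2, ← mul_add, kdel_kwed]
    split_ifs <;> simp
  rw [kD, Finset.sum_mul, Finset.mul_sum, ← Finset.sum_add_distrib, Finset.sum_congr rfl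
    (fun l _ => e l)]
  simp

/-- `O` is null-homotopic by a homotopy which preserves supports in `C`. -/
def KGood (C : KX N ι → Prop) (D O : Module.End S (KPhi S N ι)) : Prop :=
  ∃ h : Module.End S (KPhi S N ι), (∀ v, SupOn C v → SupOn C (h v)) ∧ D * h + h * D = O

theorem KGood.zero {C : KX N ι → Prop} {D : Module.End S (KPhi S N ι)} : KGood C D 0 :=
  ⟨0, fun _ _ => SupOn.zero, by simp⟩

theorem KGood.sub {C : KX N ι → Prop} {D O O' : Module.End S (KPhi S N ι)}
    (h : KGood C D O) (h' : KGood C D O') : KGood C D (O - O') := by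
  obtain ⟨a, ha, ha'⟩ := h
  obtain ⟨b, hb, hb'⟩ := h'
  refine ⟨a - b, fun v hv => ?_, ?_⟩
  · exact (ha v hv).sub (hb v hv)
  · rw [← ha', ← hb']
    refine LinearMap.ext fun v => ?_
    simp only [LinearMap.add_apply, LinearMap.sub_apply, Module.End.mul_apply, map_sub]
    abel

def kcone (ε : ι → Cnd) (L : List ι) (μ : ι → ℤ) : Prop :=
  ∀ i, (ε i = Cnd.plus → 0 ≤ μ i) ∧ (ε i = Cnd.minus → μ i ≤ 0 ∧ (i ∈ L → μ i ≤ -1))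

theorem kGood_step (x : ℕ → S) (c : ℕ) (hx : ∀ k, c ≤ k → x k = 0) (ε : ι → Cnd)
    (hε : ∀ i, ε i ≠ Cnd.kept)
    (C : KX N ι → Prop) (D : Module.End S (KPhi S N ι)) (j : ι) (L : List ι)
    (h : ∀ μ, kcone ε (j :: L) μ → ∀ k, KGood C D (kshift S N μ * kF N x (j :: L) k)) :
    ∀ μ, kcone ε L μ → ∀ k, KGood C D (kshift S N μ * kF N x L k) := by
  by_cases hj : ε j = Cnd.minus
  · have main : ∀ m, ∀ μ, kcone ε L μ → ∀ k, c + L.length ≤ k + m →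
        KGood C D (kshift S N μ * kF N x L k) := by
      intro m
      induction m with
      | zero =>
        intro μ _ k hk
        rw [kF_eq_zero x c hx L k (by simpa using hk), mul_zero]
        exact KGood.zero
      | succ m ih =>
        intro μ hμ k hk
        have hc1 : kcone ε (j :: L) (μ - Pi.single j 1) := by
          intro i
          by_cases hi : i = j
          · subst hi
            simp only [hj, Pi.sub_apply, Pi.single_eq_same]
            have := (hμ i).2 hj
            refine ⟨by simp, fun _ => ⟨by omega, fun _ => by omega⟩⟩
          · have := hμ i
            simpa [hi] using this
        have hc2 : kcone ε L (μ - Pi.single j 1) := by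
          intro i
          have := hc1 i
          exact ⟨this.1, fun h1 => ⟨(this.2 h1).1, fun h2 => (this.2 h1).2 (by simp [h2])⟩⟩
        have e : kshift S N μ * kF N x L k =
            kshift S N (μ - Pi.single j 1) * kF N x (j :: L) (k + 1) -
            kshift S N (μ - Pi.single j 1) * kF N x L (k + 1) := by
          rw [kF, mul_add, ← mul_assoc, ← kshift_add, sub_add_cancel]
          exact (add_sub_cancel_left (G := Module.End S (KPhi S N ι)) _ _).symm
        rw [e]
        exact (h _ hc1 _).sub (ih _ hc2 _ (by omega))
    intro μ hμ k
    exact main (c + L.length) μ hμ k (by omega)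
  · have hc : ∀ μ, kcone ε L μ → kcone ε (j :: L) μ := by
      intro μ hμ i
      by_cases hi : i = j
      · subst hi
        exact ⟨(hμ i).1, fun h' => absurd h' hj⟩
      · simpa [hi] using hμ i
    intro μ hμ k
    induction k generalizing μ with
    | zero => exact h μ (hc μ hμ) 0
    | succ k ih =>
      have hc1 : kcone ε L (μ + Pi.single j 1) := by
        intro i
        by_cases hi : i = j
        · subst hi
          refine ⟨fun h' => ?_, fun h' => absurd h' hj⟩
          have := (hμ i).1 h'
          simp; omega
        · simpa [hi] using hμ i
      have e : kshift S N μ * kF N x L (k + 1) =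
          kshift S N μ * kF N x (j :: L) (k + 1) -
          kshift S N (μ + Pi.single j 1) * kF N x L k := by
        rw [kF, mul_add, kshift_add, mul_assoc]
        exact (add_sub_cancel_right (G := Module.End S (KPhi S N ι)) _ _).symm
      rw [e]
      exact (h _ (hc μ hμ) _).sub (ih _ hc1)

theorem kGood_nil (x : ℕ → S) (c : ℕ) (hx : ∀ k, c ≤ k → x k = 0) (ε : ι → Cnd)
    (hε : ∀ i, ε i ≠ Cnd.kept)
    (C : KX N ι → Prop) (D : Module.End S (KPhi S N ι)) (L : List ι)
    (h : ∀ μ, kcone ε L μ → ∀ k, KGood C D (kshift S N μ * kF N x L k)) :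
    ∀ μ, kcone ε [] μ → ∀ k, KGood C D (kshift S N μ * kF N x [] k) := by
  induction L with
  | nil => exact h
  | cons j L ih => exact ih (kGood_step x c hx ε hε C D j L h)

end KoszulF

section KoszulStage
variable {K : Type} [Field K] {n : ℕ} {N : ℕ} {ι : Type} [DecidableEq ι]

def kR (L : List ι) (y y' : KX N ι) : Prop :=
  y'.1 = y.1 ∧ ∀ i, y'.2 i = y.2 i ∨ (i ∈ L ∧ y'.2 i = y.2 i + 1)

theorem kshift_OpR (μ : ι → ℤ) : OpR (K := K) (n := n) (fun y y' : KX N ι => y' = (y.1, y.2 + μ)) 0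
    (kshift (MvPolynomial (Fin n) K) N μ) :=
  OpR.of_single fun y => Or.inr ⟨_, 1, rfl, MvPolynomial.isHomogeneous_one _ _,
    kshift_single μ y 1⟩

theorem ksgn_hom (k : Fin N) (b : Finset (Fin N)) :
    (ksgn (MvPolynomial (Fin n) K) k b).IsHomogeneous 0 := by
  have : ksgn (MvPolynomial (Fin n) K) k b = MvPolynomial.C (ksgn K k b) := by
    simp [ksgn]
  rw [this]
  exact MvPolynomial.isHomogeneous_C _ _

theorem kdel_OpR (k : Fin N) : OpR (K := K) (n := n)
    (fun y y' : KX N ι => y.1.card = y'.1.card + 1 ∧ y'.2 = y.2) 0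
    (kdel (MvPolynomial (Fin n) K) ι k) := by
  refine OpR.of_single fun y => ?_
  rw [kdel_single]
  by_cases h : k ∈ y.1
  · right
    refine ⟨_, _, ⟨?_, ?_⟩, ?_, if_pos h⟩
    · exact (Finset.card_erase_add_one h).symm
    · rfl
    · rw [one_mul]; exact ksgn_hom _ _
  · left; simp [h]

theorem kwed_OpR (k : Fin N) : OpR (K := K) (n := n)
    (fun y y' : KX N ι => y'.1.card = y.1.card + 1 ∧ y'.2 = y.2) 0
    (kwed (MvPolynomial (Fin n) K) ι k) := by
  refine OpR.of_single fun y => ?_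
  rw [kwed_single]
  by_cases h : k ∈ y.1
  · left; simp [h]
  · right
    refine ⟨_, _, ⟨?_, ?_⟩, ?_, if_neg h⟩
    · exact Finset.card_insert_of_notMem h
    · rfl
    · rw [one_mul]; exact ksgn_hom _ _

theorem kF_OpR (x : ℕ → MvPolynomial (Fin n) K) (hx : ∀ k, (x k).IsHomogeneous 1) (L : List ι)
    (hL : L.Nodup) : ∀ k, OpR (kR L) 1 (kF N x L k) := by
  induction L with
  | nil =>
    intro k
    refine OpR.of_single fun y => Or.inr ⟨y, x k, ⟨rfl, fun i => Or.inl rfl⟩, hx k, ?_⟩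
    simp [kF]
  | cons j L ih =>
    rw [List.nodup_cons] at hL
    have m : ∀ k, OpR (kR (j :: L)) 1 (kF N x L k) := fun k => (ih hL.2 k).mono fun y y' h =>
      ⟨h.1, fun i => (h.2 i).imp id fun h' => ⟨by simp [h'.1], h'.2⟩⟩
    intro k
    cases k with
    | zero => exact m 0
    | succ k =>
      refine (m (k + 1)).add ?_
      have := (kshift_OpR (K := K) (n := n) (N := N) (Pi.single j 1 : ι → ℤ)).mul (ih hL.2 k)
      rw [zero_add] at this
      refine this.mono ?_
      rintro y z ⟨w, ⟨h1, h2⟩, rfl⟩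
      refine ⟨h1, fun i => ?_⟩
      by_cases hi : i = j
      · subst hi
        right
        rcases h2 i with h3 | h3
        · simp [h3]
        · exact absurd h3.1 hL.1
      · simpa [hi] using h2 i

theorem kD_OpR (x : ℕ → MvPolynomial (Fin n) K) (hx : ∀ k, (x k).IsHomogeneous 1) (L : List ι)
    (hL : L.Nodup) : OpR (fun y y' : KX N ι => y.1.card = y'.1.card + 1 ∧
      ∀ i, y.2 i ≤ y'.2 i ∧ y'.2 i ≤ y.2 i + 1) 1 (kD N x L) := by
  refine OpR.sum _ fun k => ?_
  refine ((kF_OpR x hx L hL k).mul (kdel_OpR k)).mono ?_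
  rintro y z ⟨w, ⟨h1, h2⟩, h3, h4⟩
  refine ⟨by rw [h3, h1], fun i => ?_⟩
  have := h4 i
  rw [h2] at this
  omega

theorem kD_stage [Fintype ι] (c : ℕ) (hN : N = c + Fintype.card ι) (gap : ι → ℕ)
    (x : ℕ → MvPolynomial (Fin n) K) (hx : ∀ k, (x k).IsHomogeneous 1)
    (hx0 : ∀ k, c ≤ k → x k = 0) :
    Stage (fun y : KX N ι => y.1.card) (fun y => y.2) gap (Set.range x) ∅
      (kD N x (Finset.univ : Finset ι).toList) := by
  have HD := kD_OpR (N := N) x hx (Finset.univ : Finset ι).toList (Finset.nodup_toList _)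
  have hlen : (Finset.univ : Finset ι).toList.length = Fintype.card ι := by simp
  refine ⟨?_, ?_, ?_, ?_, ?_, ?_⟩
  · intro ε hε v hv
    refine HD.sup ?_ v hv
    rintro y z ⟨h1, h2⟩ hy i
    have h3 := hy i
    have h4 := h2 i
    have h5 : ε i ≠ Cnd.kept := by simp [hε]
    cases h : ε i
    · simp only [h, condP, dirU] at h3 ⊢; omega
    · simp only [h, condP, dirW] at h3 ⊢; omega
    · trivial
    · exact absurd h h5
  · intro ε hε v hv
    have := kD_sq (N := N) x (Finset.univ : Finset ι).toList
    rw [← Module.End.mul_apply, this]; rfl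
  · rintro ε hε _ ⟨l, rfl⟩ v hv hDv
    have h5 : ∀ i, ε i ≠ Cnd.kept := by simp [hε]
    have := kGood_nil (N := N) x c hx0 ε h5 (chartP (fun y : KX N ι => y.1.card) (fun y => y.2) gap ε)
      (kD N x (Finset.univ : Finset ι).toList) (Finset.univ : Finset ι).toList ?_ 0 ?_ l
    · obtain ⟨h, h1, h2⟩ := this
      refine ⟨1, h v, h1 v hv, ?_⟩
      have := LinearMap.congr_fun h2 v
      rw [kshift_zero, one_mul] at this
      simp only [LinearMap.add_apply, Module.End.mul_apply, hDv, map_zero, add_zero, kF] at this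
      rw [this]; simp
    · intro μ hμ k
      by_cases hk : k < N
      · refine ⟨_, ?_, kD_homotopy x _ μ ⟨k, hk⟩⟩
        intro v hv
        refine OpR.sup ((kshift_OpR μ).mul (kwed_OpR ⟨k, hk⟩)) ?_ v hv
        rintro y z ⟨w, ⟨h1, h2⟩, rfl⟩ hy i
        have h3 := hy i
        have h4 := hμ i
        have h5 : ε i ≠ Cnd.kept := by simp [hε]
        cases h : ε i
        · simp only [h, condP, dirU, h2, Pi.add_apply] at h3 h4 ⊢
          have := h4.1 trivial
          omega
        · simp only [h, condP, dirW, h2, Pi.add_apply, h1] at h3 h4 ⊢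
          have := (h4.2 trivial).2 (by simp)
          push_cast
          omega
        · trivial
        · exact absurd h h5
      · rw [kF_eq_zero x c hx0 _ k (by rw [hlen]; omega), mul_zero]
        exact KGood.zero
    · intro i; simp
  · intro m v hv
    exact HD.sup (fun y z h hy => by have := h.1; omega) v hv
  · intro m _ v hv
    exact HD.sup (fun y z h hy => by have := h.1; omega) v hv
  · intro δ v hv
    exact HD.hom (fun y z h => h.1) δ v hv

end KoszulStage

section Final
variable {K : Type} [Field K] {n : ℕ} {N : ℕ} {ι : Type} [Fintype ι] [DecidableEq ι]

/-- The basis of the `i`-th free module of the final complex. -/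
def yB (N : ℕ) (gap : ι → ℕ) (m : ℕ) : Finset (KX N ι) :=
  (Finset.powersetCard m Finset.univ) ×ˢ
    Fintype.piFinset (fun j => Finset.Ico (min 0 ((gap j : ℤ) - m)) (max 0 ((gap j : ℤ) - m)))

theorem yB_card (gap : ι → ℕ) (m : ℕ) :
    (yB N gap m).card = N.choose m * ∏ j, ((gap j : ℤ) - m).natAbs := by
  rw [yB, Finset.card_product, Finset.card_powersetCard, Fintype.card_piFinset]
  simp only [Finset.card_univ, Fintype.card_fin, Int.card_Ico]
  congr 1
  refine Finset.prod_congr rfl fun j _ => ?_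
  omega

def allKept (gap : ι → ℕ) (y : KX N ι) : Prop :=
  chartP (fun y : KX N ι => y.1.card) (fun y => y.2) gap (fun _ => Cnd.kept) y

theorem mem_yB (gap : ι → ℕ) (m : ℕ) (y : KX N ι) :
    y ∈ yB N gap m ↔ y.1.card = m ∧ allKept gap y := by
  rw [yB, Finset.mem_product, Finset.mem_powersetCard, Fintype.mem_piFinset]
  simp only [Finset.subset_univ, true_and, Finset.mem_Ico]
  constructor
  · rintro ⟨h1, h2⟩
    refine ⟨h1, fun j => ?_⟩
    have := h2 j
    simp only [condP, keptP, dirU, dirW]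
    omega
  · rintro ⟨h1, h2⟩
    refine ⟨h1, fun j => ?_⟩
    have := h2 j
    simp only [condP, keptP, dirU, dirW] at this
    omega

/-- Enumeration of the basis. -/
def yE (N : ℕ) (gap : ι → ℕ) (m : ℕ) (p : Fin (yB N gap m).card) : KX N ι :=
  ((yB N gap m).equivFin.symm p : KX N ι)

theorem yE_mem (gap : ι → ℕ) (m : ℕ) (p : Fin (yB N gap m).card) :
    yE N gap m p ∈ yB N gap m := ((yB N gap m).equivFin.symm p).2

theorem yE_inj (gap : ι → ℕ) (m : ℕ) : Function.Injective (yE N gap m) :=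
  Subtype.val_injective.comp (Equiv.injective _)

theorem yE_surj (gap : ι → ℕ) (m : ℕ) (y : KX N ι) (hy : y ∈ yB N gap m) :
    ∃ p, yE N gap m p = y := ⟨(yB N gap m).equivFin ⟨y, hy⟩, by simp [yE]⟩

theorem op_apply_yB (D : Module.End (MvPolynomial (Fin n) K)
    (KX N ι →₀ MvPolynomial (Fin n) K)) (gap : ι → ℕ) (m : ℕ)
    (v : KX N ι →₀ MvPolynomial (Fin n) K) (hv : SupOn (fun y => y ∈ yB N gap m) v) (y' : KX N ι) :
    D v y' = ∑ p, v (yE N gap m p) * D (Finsupp.single (yE N gap m p) 1) y' := by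
  rw [op_apply]
  rw [Finset.sum_subset (s₂ := yB N gap m) (fun y hy => hv y (Finsupp.mem_support_iff.1 hy))
    (fun y _ hy => by rw [Finsupp.notMem_support_iff.1 hy, zero_mul])]
  rw [← Finset.sum_coe_sort, ← Equiv.sum_comp (yB N gap m).equivFin.symm]
  rfl

/-- Embedding of coordinates in the ambient module. -/
def emb (gap : ι → ℕ) (m : ℕ) (f : Fin (yB N gap m).card → MvPolynomial (Fin n) K) :
    KX N ι →₀ MvPolynomial (Fin n) K := ∑ p, Finsupp.single (yE N gap m p) (f p)

theorem emb_apply (gap : ι → ℕ) (m : ℕ) (f : Fin (yB N gap m).card → MvPolynomial (Fin n) K)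
    (p) : emb gap m f (yE N gap m p) = f p := by
  rw [emb, Finsupp.finsetSum_apply, Finset.sum_eq_single p]
  · simp
  · intro q _ hq
    rw [Finsupp.single_apply, if_neg]
    exact fun h => hq (yE_inj gap m h)
  · simp

theorem emb_sup (gap : ι → ℕ) (m : ℕ) (f : Fin (yB N gap m).card → MvPolynomial (Fin n) K) :
    SupOn (fun y => y ∈ yB N gap m) (emb gap m f) := by
  intro y hy
  rw [emb, Finsupp.finsetSum_apply] at hy
  obtain ⟨p, _, hp⟩ := Finset.exists_ne_zero_of_sum_ne_zero hy
  rw [Finsupp.single_apply] at hp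
  by_cases h : yE N gap m p = y
  · rw [← h]; exact yE_mem _ _ _
  · simp [h] at hp

theorem stage_ent {gap : ι → ℕ} {xs : Set (MvPolynomial (Fin n) K)}
    {D : Module.End (MvPolynomial (Fin n) K) (KX N ι →₀ MvPolynomial (Fin n) K)}
    (H : Stage (fun y : KX N ι => y.1.card) (fun y => y.2) gap xs Finset.univ D)
    (e : ℕ → ℕ) (he : StrictMono e) (h1 : ∀ m ≤ N, (∃ j, gap j = m) ∨ ∃ i, e i = m)
    (h2 : ∀ j i, gap j ≠ e i) (y y' : KX N ι) (hy : allKept gap y)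
    (h : D (Finsupp.single y 1) y' ≠ 0) :
    ∃ i, y ∈ yB N gap (e (i + 1)) ∧ y' ∈ yB N gap (e i) := by
  classical
  have sup : ∀ T : KX N ι → Prop, T y → SupOn T (Finsupp.single y (1 : MvPolynomial (Fin n) K)) := by
    intro T hT z hz
    rw [Finsupp.single_apply] at hz
    by_cases h : y = z
    · rwa [← h]
    · simp [h] at hz
  have dg : ∀ z : KX N ι, allKept gap z → ∃ i, z.1.card = e i := by
    intro z hz
    rcases h1 z.1.card (by simpa using Finset.card_le_univ z.1) with ⟨j, hj⟩ | ⟨i, hi⟩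
    · have := hz j
      simp only [condP, keptP, dirU, dirW] at this
      omega
    · exact ⟨i, hi.symm⟩
  have hy' : allKept gap y' := H.pres (fun _ => Cnd.kept) (by simp) _ (sup _ hy) y' h
  obtain ⟨a, ha⟩ := dg y hy
  obtain ⟨b, hb⟩ := dg y' hy'
  have l1 : y'.1.card < e a := H.lt (e a) _ (sup _ (by simp [ha])) y' h
  have l2 : b < a := by rw [hb] at l1; exact he.lt_iff_lt.1 l1
  obtain ⟨i, rfl⟩ : ∃ i, a = i + 1 := ⟨a - 1, by omega⟩
  have l3 : e i ≤ y'.1.card := H.gt (e i) (fun j _ => h2 j i) _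
    (sup _ (by simp only [ha]; exact he (by omega))) y' h
  have l4 : i ≤ b := by rw [hb] at l3; exact he.le_iff_le.1 l3
  obtain rfl : b = i := by omega
  exact ⟨b, (mem_yB _ _ _).2 ⟨ha, hy⟩, (mem_yB _ _ _).2 ⟨hb, hy'⟩⟩

/-- Membership of homogeneous polynomials in `homogZ`. -/
theorem mem_homogZ_of (p : MvPolynomial (Fin n) K) (a : ℕ) (z : ℤ) (hz : z = a)
    (hp : p.IsHomogeneous a) : p ∈ homogZ K n z := by
  subst hz
  have : p ∈ ⨆ (_ : (0 : ℤ) ≤ (a : ℤ)),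
      MvPolynomial.homogeneousSubmodule (Fin n) K (a : ℤ).toNat := by
    rw [iSup_pos (by omega : (0 : ℤ) ≤ (a : ℤ))]
    simpa using hp
  exact this

set_option maxHeartbeats 2000000 in
theorem stage_complex {gap : ι → ℕ} (c : ℕ) (hc : c ≤ n)
    {D : Module.End (MvPolynomial (Fin n) K) (KX N ι →₀ MvPolynomial (Fin n) K)}
    (xs : Set (MvPolynomial (Fin n) K))
    (hxs : ∀ l : Fin c, (MvPolynomial.X (Fin.castLE hc l) : MvPolynomial (Fin n) K) ∈ xs)
    (H : Stage (fun y : KX N ι => y.1.card) (fun y => y.2) gap xs Finset.univ D)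
    (e : ℕ → ℕ) (he : StrictMono e) (hN : N = e c)
    (h1 : ∀ m ≤ N, (∃ j, gap j = m) ∨ ∃ i, e i = m)
    (h2 : ∀ j i, gap j ≠ e i) (d0 : ℤ) :
    ∃ F : FreeComplex K n, F.len = c ∧ IsResolution F ∧ (∀ i p, F.deg i p = e i + d0) ∧
      ∀ i, F.rk i = N.choose (e i) * ∏ j, ((gap j : ℤ) - e i).natAbs := by
  classical
  have ent := stage_ent H e he h1 h2
  have hinj : ∀ (z : KX N ι) a b, z ∈ yB N gap (e a) → z ∈ yB N gap (e b) → a = b := by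
    intro z a b ha hb
    rw [mem_yB] at ha hb
    exact he.injective (ha.1.symm.trans hb.1)
  have hmap : ∀ i v, SupOn (fun y => y ∈ yB N gap (e (i + 1))) v →
      SupOn (fun y => y ∈ yB N gap (e i)) (D v) := by
    intro i v hv y' hy'
    rw [op_apply_yB D gap _ v hv] at hy'
    obtain ⟨p, _, hp⟩ := Finset.exists_ne_zero_of_sum_ne_zero hy'
    have hm := yE_mem (N := N) gap (e (i + 1)) p
    obtain ⟨a, ha, hb⟩ := ent _ _ ((mem_yB _ _ _).1 hm).2 (right_ne_zero_of_mul hp)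
    obtain rfl : i = a := by have := hinj _ _ _ hm ha; omega
    exact hb
  let dd : (i : ℕ) → Matrix (Fin (yB N gap (e i)).card) (Fin (yB N gap (e (i + 1))).card)
      (PolyS K n) := fun i p q => D (Finsupp.single (yE N gap (e (i + 1)) q) 1) (yE N gap (e i) p)
  have sing : ∀ m q, SupOn (fun y => y ∈ yB N gap m)
      (Finsupp.single (yE N gap m q) (1 : MvPolynomial (Fin n) K)) := by
    intro m q z hz
    rw [Finsupp.single_apply] at hz
    by_cases h : yE N gap m q = z
    · rw [← h]; exact yE_mem _ _ _
    · simp [h] at hz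
  have kept : ∀ m v, SupOn (fun y => y ∈ yB N gap m) v →
      SupOn (chartP (fun y : KX N ι => y.1.card) (fun y => y.2) gap (fun _ => Cnd.kept)) v :=
    fun m v (hv : SupOn _ (_ : KX N ι →₀ MvPolynomial (Fin n) K)) =>
      hv.mono fun y hy => ((mem_yB _ _ _).1 hy).2
  have hsq : ∀ m v, SupOn (fun y => y ∈ yB N gap m) v → D (D v) = 0 := fun m v hv =>
    H.sq (fun _ => Cnd.kept) (by simp) v (kept m v hv)
  have hmul : ∀ i (v : KX N ι →₀ MvPolynomial (Fin n) K),
      SupOn (fun y => y ∈ yB N gap (e (i + 1))) v →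
      (dd i).mulVec (fun q => v (yE N gap (e (i + 1)) q)) =
        fun p => D v (yE N gap (e i) p) := by
    intro i v hv
    funext p
    rw [op_apply_yB D gap _ v hv]
    simp only [Matrix.mulVec, dotProduct, dd]
    exact Finset.sum_congr rfl fun q _ => mul_comm _ _
  have hcomplex : ∀ i, dd i * dd (i + 1) = 0 := by
    intro i
    refine Matrix.ext fun p q => ?_
    have := congrFun (hmul i (D (Finsupp.single (yE N gap (e (i + 1 + 1)) q) 1))
      (hmap _ _ (sing _ q))) p
    rw [hsq _ _ (sing _ q)] at this
    rw [Matrix.mul_apply]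
    exact this
  have hrk0 : ∀ i, c < i → (yB N gap (e i)).card = 0 := by
    intro i hi
    rw [yB_card, Nat.choose_eq_zero_of_lt, zero_mul]
    rw [hN]; exact he hi
  refine ⟨⟨c, fun i => (yB N gap (e i)).card, fun i _ => e i + d0, dd, hrk0, ?_, hcomplex⟩,
    rfl, ?_, fun i p => rfl, fun i => yB_card _ _⟩
  · intro i p q
    have hq := (mem_yB _ _ _).1 (yE_mem (N := N) gap (e (i + 1)) q)
    have hp := (mem_yB _ _ _).1 (yE_mem (N := N) gap (e i) p)
    have hlt : e i < e (i + 1) := he (by omega)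
    refine mem_homogZ_of _ (e (i + 1) - e i) _ (by omega) ?_
    have g : GrOn (fun y : KX N ι => y.1.card) (e (i + 1))
        (Finsupp.single (yE N gap (e (i + 1)) q) (1 : MvPolynomial (Fin n) K)) := by
      intro z
      rw [Finsupp.single_apply]
      split_ifs with hz
      · rw [← hz]
        simp only [hq.1]
        simp [MvPolynomial.isHomogeneous_one]
      · simp [MvPolynomial.isHomogeneous_zero]
    have := (H.hom _ _ g (yE N gap (e i) p)).1
    simp only [hp.1] at this
    exact this
  · intro i
    apply le_antisymm
    · intro z hz
      rw [LinearMap.mem_ker] at hz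
      refine acyclicity_aux (List.ofFn fun l : Fin c =>
          (MvPolynomial.X (Fin.castLE hc l) : MvPolynomial (Fin n) K))
        (fun i => Fin (yB N gap (e i)).card → MvPolynomial (Fin n) K)
        (fun i => (dd i).mulVecLin) ?_ c 0 (fun i => isWeaklyRegular_X c hc _) ?_ ?_ i
        (Nat.zero_le _) ?_ z hz
      · intro i z
        simp only [Matrix.mulVecLin_apply, Matrix.mulVec_mulVec, hcomplex, Matrix.zero_mulVec]
      · intro i hi
        have := hrk0 i hi
        have : IsEmpty (Fin (yB N gap (e i)).card) := by rw [this]; infer_instance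
        infer_instance
      · intro r hr i _ z hz
        rw [List.mem_ofFn] at hr
        obtain ⟨l, rfl⟩ := hr
        have hv := emb_sup (N := N) gap (e (i + 1)) z
        have e1 := hmul i _ hv
        simp only [emb_apply] at e1
        have hDv : D (emb gap (e (i + 1)) z) = 0 := by
          ext1 y
          by_contra hy
          obtain ⟨p, rfl⟩ := yE_surj gap (e i) y (hmap _ _ hv y hy)
          apply hy
          rw [← congrFun e1 p]
          exact congrFun hz p
        obtain ⟨k, u, hu, hk⟩ := H.tors (fun _ => Cnd.kept) (by simp) _ (hxs l) _
          (kept _ _ hv) hDv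
        have hw := supOn_prj (fun y => y ∈ yB N gap (e (i + 1 + 1))) u
        refine ⟨k, fun q => prj (fun y => y ∈ yB N gap (e (i + 1 + 1))) u
          (yE N gap (e (i + 1 + 1)) q), ?_⟩
        rw [Matrix.mulVecLin_apply, hmul (i + 1) _ hw]
        funext p
        have e2 := DFunLike.congr_fun hk (yE N gap (e (i + 1)) p)
        rw [Finsupp.smul_apply, emb_apply] at e2
        rw [Pi.smul_apply, e2]
        rw [← sub_eq_zero, ← Finsupp.sub_apply, ← map_sub, op_apply]
        refine Finset.sum_eq_zero fun y _ => ?_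
        by_contra hy
        have hy1 := left_ne_zero_of_mul hy
        rw [Finsupp.sub_apply, prj_apply] at hy1
        have hy2 : u y ≠ 0 := by
          intro h; simp [h] at hy1
        obtain ⟨a, ha, hb⟩ := ent y _ (hu y hy2) (right_ne_zero_of_mul hy)
        obtain rfl : i + 1 = a := hinj _ _ _ (yE_mem _ _ _) hb
        simp [ha] at hy1
      · rw [List.length_ofFn]; omega
    · rintro _ ⟨w, rfl⟩
      rw [LinearMap.mem_ker]
      change (dd i).mulVec ((dd (i + 1)).mulVec w) = 0
      rw [Matrix.mulVec_mulVec, hcomplex, Matrix.zero_mulVec]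

end Final

theorem exists_complex (c n : ℕ) (hc : c ≤ n) (K : Type) [Field K] (e : ℕ → ℕ) (he : StrictMono e)
    (d0 : ℤ) :
    ∃ F : FreeComplex K n, F.len = c ∧ IsResolution F ∧ (∀ i p, F.deg i p = e i + d0) ∧
      ∀ i, F.rk i = (e c).choose (e i) *
        ∏ g ∈ Finset.range (e c + 1) \ (Finset.range (c + 1)).image e,
          ((g : ℤ) - e i).natAbs := by
  classical
  set G := Finset.range (e c + 1) \ (Finset.range (c + 1)).image e with hG
  have hsub : (Finset.range (c + 1)).image e ⊆ Finset.range (e c + 1) := by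
    intro m hm
    obtain ⟨i, hi, rfl⟩ := Finset.mem_image.1 hm
    have := he.monotone (show i ≤ c by simpa [Nat.lt_succ_iff] using hi)
    simp; omega
  have hcard : e c = c + Fintype.card {g // g ∈ G} := by
    rw [Fintype.card_coe, hG, Finset.card_sdiff_of_subset hsub,
      Finset.card_image_of_injective _ he.injective, Finset.card_range, Finset.card_range]
    have := he.le_apply (x := c)
    omega
  let x : ℕ → MvPolynomial (Fin n) K := fun k =>
    if h : k < c then MvPolynomial.X (Fin.castLE hc ⟨k, h⟩) else 0
  obtain ⟨D, hD⟩ := Stage.exists_univ (K := K) (n := n) (X := KX (e c) {g // g ∈ G})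
    (deg := fun y => y.1.card) (ex := fun y => y.2)
    (gap := fun g : {g // g ∈ G} => g.1) (xs := Set.range x) Subtype.val_injective
    ⟨_, kD_stage c hcard _ x (by
      intro k
      by_cases h : k < c
      · simp only [x, h, dif_pos]; exact MvPolynomial.isHomogeneous_X _ _
      · simp only [x, h, dif_neg, not_false_eq_true]; exact MvPolynomial.isHomogeneous_zero _ _ _)
      (by intro k hk; simp [x, hk.not_gt])⟩
  obtain ⟨F, h1, h2, h3, h4⟩ := stage_complex c hc (Set.range x) (by
      intro l; exact ⟨l.1, by simp [x]; rfl⟩) hD e he rfl (by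
      intro m hm
      by_cases h : m ∈ G
      · exact Or.inl ⟨⟨m, h⟩, rfl⟩
      · right
        simp only [hG, Finset.mem_sdiff, Finset.mem_range, not_and, not_not] at h
        obtain ⟨i, _, hi⟩ := Finset.mem_image.1 (h (by omega))
        exact ⟨i, hi⟩) (by
      rintro ⟨g, hg⟩ i h
      simp only at h
      subst h
      simp only [hG, Finset.mem_sdiff, Finset.mem_range] at hg
      apply hg.2
      refine Finset.mem_image_of_mem _ ?_
      have : i ≤ c := he.le_iff_le.1 (by omega)
      simp; omega) d0
  refine ⟨F, h1, h2, h3, fun i => ?_⟩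
  rw [h4, ← Finset.prod_coe_sort G]

namespace Polynomial


theorem alt_sum_eq (N : ℕ) (q : ℚ[X]) :
    ∑ m ∈ Finset.range (N + 1), (-1 : ℚ) ^ m * (N.choose m : ℚ) * q.eval (m : ℚ) =
      (-1) ^ N * ((fwdDiff 1)^[N] (fun x => eval x q)) (0 : ℚ) := by
  rw [fwdDiff_iter_eq_sum_shift, Finset.mul_sum]
  refine Finset.sum_congr rfl fun m hm => ?_
  have hm : m ≤ N := by simpa [Nat.lt_succ_iff] using hm
  simp only [zsmul_eq_mul, zero_add, nsmul_eq_mul, mul_one]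
  push_cast
  rw [← mul_assoc, ← mul_assoc, ← pow_add]
  congr 2
  rw [show N + (N - m) = 2 * (N - m) + m by omega, pow_add, pow_mul]
  simp

theorem alt_sum_zero (N : ℕ) (q : ℚ[X]) (h : q.natDegree < N) :
    ∑ m ∈ Finset.range (N + 1), (-1 : ℚ) ^ m * (N.choose m : ℚ) * q.eval (m : ℚ) = 0 := by
  rw [alt_sum_eq, fwdDiff_iter_eq_zero_of_degree_lt h]; simp

theorem alt_sum_ne (N : ℕ) (q : ℚ[X]) (h : q.natDegree = N) (h0 : q ≠ 0) :
    ∑ m ∈ Finset.range (N + 1), (-1 : ℚ) ^ m * (N.choose m : ℚ) * q.eval (m : ℚ) ≠ 0 := by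
  rw [alt_sum_eq, ← h, fwdDiff_iter_degree_eq_factorial]
  simp [h0, Nat.factorial_ne_zero]

/-- The polynomial vanishing at the gaps. -/
def gapPoly (G : Finset ℕ) : ℚ[X] := ∏ g ∈ G, (C (g : ℚ) - X)

theorem gapPoly_natDegree (G : Finset ℕ) : (gapPoly G).natDegree = G.card := by
  rw [gapPoly, Polynomial.natDegree_prod]
  · rw [Finset.sum_congr rfl (g := fun _ => 1), Finset.sum_const, smul_eq_mul, mul_one]
    intro g _
    rw [← neg_sub, natDegree_neg, natDegree_X_sub_C]
  · intro g _
    rw [← neg_sub, neg_ne_zero]; exact X_sub_C_ne_zero _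

theorem gapPoly_ne (G : Finset ℕ) : gapPoly G ≠ 0 := by
  rw [gapPoly, Finset.prod_ne_zero_iff]
  intro g _
  rw [← neg_sub, neg_ne_zero]; exact X_sub_C_ne_zero _

theorem sum_to_alt (c : ℕ) (e : ℕ → ℕ) (he : StrictMono e) (p : ℚ[X]) :
    ∑ i ∈ Finset.range (c + 1), (-1 : ℚ) ^ i * (((e c).choose (e i) *
        ∏ g ∈ Finset.range (e c + 1) \ (Finset.range (c + 1)).image e,
          ((g : ℤ) - e i).natAbs : ℕ) : ℚ) * p.eval (e i : ℚ) =
    ∑ m ∈ Finset.range (e c + 1), (-1 : ℚ) ^ m * ((e c).choose m : ℚ) *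
      (gapPoly (Finset.range (e c + 1) \ (Finset.range (c + 1)).image e) * p).eval (m : ℚ) := by
  set G := Finset.range (e c + 1) \ (Finset.range (c + 1)).image e with hG
  have hsub : (Finset.range (c + 1)).image e ⊆ Finset.range (e c + 1) := by
    intro m hm
    obtain ⟨i, hi, rfl⟩ := Finset.mem_image.1 hm
    have := he.monotone (show i ≤ c by simpa [Nat.lt_succ_iff] using hi)
    simp; omega
  rw [← Finset.sum_subset hsub]
  · rw [Finset.sum_image (fun a _ b _ h => he.injective h)]
    refine Finset.sum_congr rfl fun i hi => ?_
    have hi : i ≤ c := by simpa [Nat.lt_succ_iff] using hi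
    have cnt : (G.filter (fun g => g < e i)).card + i = e i := by
      have hdis : Disjoint (G.filter (fun g => g < e i)) ((Finset.range i).image e) := by
        rw [Finset.disjoint_left]
        intro m hm hm'
        obtain ⟨a, ha, rfl⟩ := Finset.mem_image.1 hm'
        have ha : a < i := by simpa using ha
        rw [Finset.mem_filter, hG, Finset.mem_sdiff] at hm
        exact hm.1.2 (Finset.mem_image_of_mem _ (by simp; omega))
      have hun : (G.filter (fun g => g < e i)) ∪ ((Finset.range i).image e) =
          Finset.range (e i) := by
        ext m
        simp only [Finset.mem_union, Finset.mem_filter, hG, Finset.mem_sdiff, Finset.mem_image,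
          Finset.mem_range]
        have hle := he.monotone hi
        constructor
        · rintro (h | ⟨a, ha, rfl⟩)
          · exact h.2
          · exact he ha
        · intro hm
          by_cases h : ∃ a, e a = m
          · right
            obtain ⟨a, rfl⟩ := h
            exact ⟨a, he.lt_iff_lt.1 hm, rfl⟩
          · left
            refine ⟨⟨by omega, ?_⟩, hm⟩
            rintro ⟨a, _, rfl⟩
            exact h ⟨a, rfl⟩
      have := Finset.card_union_of_disjoint hdis
      rw [hun, Finset.card_image_of_injective _ he.injective] at this
      simpa using this.symm
    have sgn : ∏ g ∈ G, ((g : ℚ) - e i) =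
        (-1) ^ (G.filter (fun g => g < e i)).card *
          ∏ g ∈ G, ((((g : ℤ) - e i).natAbs : ℕ) : ℚ) := by
      rw [← Finset.prod_const, Finset.prod_filter, ← Finset.prod_mul_distrib]
      refine Finset.prod_congr rfl fun g _ => ?_
      rw [Nat.cast_natAbs]
      split_ifs with h
      · rw [abs_of_neg (by omega)]; push_cast; ring
      · rw [abs_of_nonneg (by omega)]; push_cast; ring
    rw [eval_mul, gapPoly, eval_prod]
    simp only [eval_sub, eval_C, eval_X]
    rw [sgn]
    have : (-1 : ℚ) ^ i = (-1) ^ (e i) * (-1) ^ (G.filter (fun g => g < e i)).card := by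
      rw [← pow_add]
      rw [show e i + (G.filter (fun g => g < e i)).card =
        2 * (G.filter (fun g => g < e i)).card + i by omega, pow_add, pow_mul]
      simp
    rw [this]
    push_cast
    ring
  · intro m hm hm'
    rw [eval_mul, gapPoly, eval_prod, Finset.prod_eq_zero (i := m)]
    · simp
    · rw [hG, Finset.mem_sdiff]; exact ⟨hm, hm'⟩
    · simp

theorem gap_card (c : ℕ) (e : ℕ → ℕ) (he : StrictMono e) :
    (Finset.range (e c + 1) \ (Finset.range (c + 1)).image e).card + c = e c := by
  have hsub : (Finset.range (c + 1)).image e ⊆ Finset.range (e c + 1) := by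
    intro m hm
    obtain ⟨i, hi, rfl⟩ := Finset.mem_image.1 hm
    have := he.monotone (show i ≤ c by simpa [Nat.lt_succ_iff] using hi)
    simp; omega
  rw [Finset.card_sdiff_of_subset hsub,
      Finset.card_image_of_injective _ he.injective, Finset.card_range, Finset.card_range]
  have := he.le_apply (x := c)
  omega

theorem moment_zero (c : ℕ) (e : ℕ → ℕ) (he : StrictMono e) (p : ℚ[X]) (h : p.natDegree < c) :
    ∑ i ∈ Finset.range (c + 1), (-1 : ℚ) ^ i * (((e c).choose (e i) *
        ∏ g ∈ Finset.range (e c + 1) \ (Finset.range (c + 1)).image e,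
          ((g : ℤ) - e i).natAbs : ℕ) : ℚ) * p.eval (e i : ℚ) = 0 := by
  rw [sum_to_alt c e he]
  apply alt_sum_zero
  have := natDegree_mul_le (p := gapPoly (Finset.range (e c + 1) \ (Finset.range (c + 1)).image e))
    (q := p)
  rw [gapPoly_natDegree] at this
  have := gap_card c e he
  omega

theorem moment_ne (c : ℕ) (e : ℕ → ℕ) (he : StrictMono e) (p : ℚ[X]) (h : p.natDegree = c)
    (h0 : p ≠ 0) :
    ∑ i ∈ Finset.range (c + 1), (-1 : ℚ) ^ i * (((e c).choose (e i) *
        ∏ g ∈ Finset.range (e c + 1) \ (Finset.range (c + 1)).image e,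
          ((g : ℤ) - e i).natAbs : ℕ) : ℚ) * p.eval (e i : ℚ) ≠ 0 := by
  rw [sum_to_alt c e he]
  apply alt_sum_ne
  · rw [natDegree_mul (gapPoly_ne _) h0, gapPoly_natDegree, h, gap_card c e he]
  · exact mul_ne_zero (gapPoly_ne _) h0

/-- The Hilbert polynomial of the polynomial ring. -/
def hilbS (n : ℕ) : ℚ[X] :=
  C (((n - 1).factorial : ℚ))⁻¹ * ∏ k ∈ Finset.range (n - 1), (X + C ((k : ℚ) + 1))

theorem hilbS_natDegree (n : ℕ) : (hilbS n).natDegree = n - 1 := by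
  rw [hilbS, natDegree_C_mul (by simp [Nat.factorial_ne_zero]), Polynomial.natDegree_prod]
  · rw [Finset.sum_congr rfl (g := fun _ => 1)]
    · simp
    · intro k _; exact natDegree_X_add_C _
  · intro k _; exact X_add_C_ne_zero _

theorem hilbS_ne (n : ℕ) : hilbS n ≠ 0 := by
  rw [hilbS]
  refine mul_ne_zero (by simp [Nat.factorial_ne_zero]) ?_
  rw [Finset.prod_ne_zero_iff]
  intro k _; exact X_add_C_ne_zero _

theorem genHilb_eq (n : ℕ) (hn : n ≠ 0) (a : ℤ) : genHilb n a = taylor (-(a : ℚ)) (hilbS n) := by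
  rw [genHilb, if_neg hn, taylor_apply, hilbS, mul_comp, C_comp, Polynomial.prod_comp]
  congr 1
  refine Finset.prod_congr rfl fun k _ => ?_
  simp [sub_eq_add_neg]

theorem polyDim_of (c n : ℕ) (hc : c ≤ n) (e : ℕ → ℕ) (he : StrictMono e) (d0 : ℤ)
    (K : Type) [Field K] (F : FreeComplex K n) (hlen : F.len = c)
    (hdeg : ∀ i p, F.deg i p = e i + d0)
    (hrk : ∀ i, F.rk i = (e c).choose (e i) *
        ∏ g ∈ Finset.range (e c + 1) \ (Finset.range (c + 1)).image e,
          ((g : ℤ) - e i).natAbs) : polyDim (hilbPoly F) = n - c := by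
  by_cases hn : n = 0
  · have : hilbPoly F = 0 := by
      simp [hilbPoly, genHilb, hn]
    rw [this, polyDim, if_pos rfl]; omega
  have hco : ∀ i, (hilbPoly F).coeff i = ∑ a ∈ Finset.range (c + 1),
      (-1 : ℚ) ^ a * (((e c).choose (e a) *
        ∏ g ∈ Finset.range (e c + 1) \ (Finset.range (c + 1)).image e,
          ((g : ℤ) - e a).natAbs : ℕ) : ℚ) *
        ((hasseDeriv i (hilbS n)).comp (-X - C (d0 : ℚ))).eval (e a : ℚ) := by
    intro i
    rw [hilbPoly, finsetSum_coeff, hlen]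
    refine Finset.sum_congr rfl fun a _ => ?_
    rw [coeff_C_mul, mul_assoc]
    congr 1
    simp only [hdeg]
    rw [Finset.sum_const, Finset.card_univ, Fintype.card_fin, ← hrk, nsmul_eq_mul,
      ← Polynomial.C_eq_natCast, coeff_C_mul, genHilb_eq n hn, taylor_coeff, eval_comp]
    congr 2
    simp
    ring
  have hlin : (-X - C (d0 : ℚ)).natDegree = 1 := by
    rw [show (-X - C (d0 : ℚ)) = -(X + C (d0 : ℚ)) by ring, natDegree_neg, natDegree_X_add_C]
  have hz : ∀ i, n < i + 1 + c → (hilbPoly F).coeff i = 0 := by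
    intro i hi
    rw [hco]
    by_cases h : n - 1 < i
    · rw [hasseDeriv_eq_zero_of_lt_natDegree _ _ (by rwa [hilbS_natDegree])]
      simp
    · apply moment_zero c e he
      rw [natDegree_comp, natDegree_hasseDeriv, hilbS_natDegree, hlin]
      omega
  by_cases hcn : c = n
  · have : hilbPoly F = 0 := by
      ext i
      rw [hz i (by omega), coeff_zero]
    rw [this, polyDim, if_pos rfl]; omega
  · have hne : (hilbPoly F).coeff (n - 1 - c) ≠ 0 := by
      rw [hco]
      have hd : ((hasseDeriv (n - 1 - c) (hilbS n)).comp (-X - C (d0 : ℚ))).natDegree = c := by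
        rw [natDegree_comp, natDegree_hasseDeriv, hilbS_natDegree, hlin]
        omega
      refine moment_ne c e he _ hd ?_
      intro h
      rcases comp_eq_zero_iff.1 h with h' | ⟨_, h'⟩
      · have h2 := congrArg (fun q : ℚ[X] => q.coeff c) h'
        simp only [hasseDeriv_coeff, coeff_zero] at h2
        rw [show c + (n - 1 - c) = n - 1 by omega] at h2
        rcases mul_eq_zero.1 h2 with h3 | h3
        · have := Nat.choose_pos (show n - 1 - c ≤ n - 1 by omega)
          norm_cast at h3
          omega
        · have := hilbS_ne n
          rw [← leadingCoeff_ne_zero, leadingCoeff, hilbS_natDegree] at this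
          exact this h3
      · have := hlin
        rw [h', natDegree_C] at this
        omega
    have hP : hilbPoly F ≠ 0 := by
      intro h; rw [h] at hne; simp at hne
    have h1 := le_natDegree_of_ne_zero hne
    have h2 : (hilbPoly F).natDegree ≤ n - 1 - c := by
      rw [natDegree_le_iff_coeff_eq_zero]
      intro i hi
      exact hz i (by omega)
    rw [polyDim, if_neg hP]
    omega

end Polynomial

/-- For every strictly increasing sequence of integers
`d = (d_0 < … < d_c)` with `c ≤ n`, there exists a finitely generated graded
Cohen-Macaulay module `M` of codimension `c` over `S = K[x_1, …, x_n]` whose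
minimal graded free resolution is pure with degree sequence `d`.
(The module `M` is `coker (F₁ → F₀)`.) -/
theorem pure_CM_modules_exist (K : Type) [Field K] (n c : ℕ) (hc : c ≤ n)
    (d : Fin (c + 1) → ℤ) (hd : StrictMono d) :
    ∃ F : FreeComplex K n,
      IsCMcodim F c ∧
      (∀ i : ℕ, ∀ h : i ≤ c,
        F.rk i ≠ 0 ∧ ∀ p : Fin (F.rk i), F.deg i p = d ⟨i, by omega⟩) := by
  let e : ℕ → ℕ := fun i => (d ⟨min i c, by omega⟩ - d 0).toNat + (i - c)
  have he0 : ∀ i : ℕ, ∀ h : i ≤ c, ((e i : ℕ) : ℤ) + d 0 = d ⟨i, by omega⟩ := by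
    intro i h
    have h1 : d 0 ≤ d ⟨i, by omega⟩ := hd.monotone (Fin.zero_le _)
    simp only [e, min_eq_left h]
    omega
  have he : StrictMono e := by
    refine strictMono_nat_of_lt_succ fun i => ?_
    by_cases h : i < c
    · have h1 := he0 i h.le
      have h2 := he0 (i + 1) h
      have h3 : d ⟨i, by omega⟩ < d ⟨i + 1, by omega⟩ := hd (by simp [Fin.lt_def])
      omega
    · simp only [e, min_eq_right (show c ≤ i by omega), min_eq_right (show c ≤ i + 1 by omega)]
      omega
  obtain ⟨F, hlen, hres, hdeg, hrk⟩ := exists_complex c n hc K e he (d 0)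
  have hpos : ∀ i, i ≤ c → F.rk i ≠ 0 := by
    intro i hi
    rw [hrk]
    refine mul_ne_zero (Nat.choose_pos (he.monotone hi)).ne' ?_
    rw [Finset.prod_ne_zero_iff]
    intro g hg h
    rw [Finset.mem_sdiff] at hg
    apply hg.2
    rw [Finset.mem_image]
    exact ⟨i, by simp; omega, by omega⟩
  refine ⟨F, ⟨hres, ?_, ?_, hpos c le_rfl,
    Polynomial.polyDim_of c n hc e he (d 0) K F hlen hdeg hrk⟩, fun i h => ⟨hpos i h, fun p => ?_⟩⟩
  · intro i p q h
    rw [hdeg, hdeg] at h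
    have : e i < e (i + 1) := he (by omega)
    omega
  · intro i hi
    exact F.rk_eq_zero i (by omega)
  · rw [hdeg, he0 i h]


end
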